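/- arXiv:2603.21956 — 2 statements merged into one kernel-verified Lean document; each statement's English description precedes it below -/
import Mathlib

section
/- Let N ≥ 1 be an integer, p ∈ (1,∞), s ∈ (0,1), Λ > 0, and let K : ℝ^N ∖ {0} → (0,∞) be measurable with K(-z) = K(z) and K(z) ≤ Λ |z|^{-(N+sp)} for all z ≠ 0. Let Ω ⊆ ℝ^N be open, I ⊂ ℝ a bounded interval, V open, 𝒦 compact and U open with V ⊆ 𝒦 ⊆ U and closure(U) compact and contained in Ω, and let ρ > 0 satisfy B_ρ(x) ⊆ U for every x ∈ 𝒦. Let φ ∈ C²_x ∩ C¹_t(U × I) with φ, ∇_x φ, D²_x φ and ∂_t φ bounded on U × I and inf_{U × I} |∇_x φ| > 0, and suppose that for every (x,t) ∈ V × I the principal value L_K^{B_ρ} φ(x,t) exists and ∂_t φ(x,t) + L_K^{B_ρ} φ(x,t) ≥ 0. Then φ is a weak supersolution of ∂_t w + L_K^{B_ρ} w = 0 in V × I; that is, for every nonnegative smooth ψ : ℝ^N × ℝ → ℝ compactly supported in V × int(I): -∫_I ∫_U φ ∂_t ψ dx dt + (1/2) ∫_I ∬_{{(x,y) ∈ U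 × U : |x-y| < ρ}} J_p(φ(x,t)-φ(y,t)) (ψ(x,t)-ψ(y,t)) K(x-y) dx dy dt ≥ 0. -/
open MeasureTheory Set Metric Filter
open scoped ENNReal NNReal Topology Classical

noncomputable section

abbrev Euc (N : ℕ) := EuclideanSpace ℝ (Fin N)

/-- `J_p(t) = |t|^{p-2} t`. -/
def Jp (p t : ℝ) : ℝ := |t| ^ (p - 2) * t

/-- A symmetric kernel comparable to the fractional `p`-Laplace kernel. -/
def IsKernel (N : ℕ) (p s lam Lam : ℝ) (K : Euc N → ℝ) : Prop :=
  Measurable K ∧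
  (∀ z : Euc N, z ≠ 0 → 0 < K z) ∧
  (∀ z : Euc N, z ≠ 0 → K (-z) = K z) ∧
  (∀ z : Euc N, z ≠ 0 →
    lam * ‖z‖ ^ (-((N : ℝ) + s * p)) ≤ K z ∧ K z ≤ Lam * ‖z‖ ^ (-((N : ℝ) + s * p)))

/-- Local weak solution of `∂ₜ u + L_K u = 0` in `Ω × I`. -/
def IsLocalWeakSolution (N : ℕ) (p s : ℝ) (K : Euc N → ℝ)
    (Ω : Set (Euc N)) (I : Set ℝ) (u : Euc N → ℝ → ℝ) : Prop :=
  (∀ J : Set ℝ, IsCompact J → J ⊆ interior I →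
    ∀ U : Set (Euc N), IsOpen U → IsCompact (closure U) → closure U ⊆ Ω →
      (∫⁻ t in J, ∫⁻ x in U, ∫⁻ y in U,
          ENNReal.ofReal (|u x t - u y t| ^ p * ‖x - y‖ ^ (-((N : ℝ) + s * p)))) < ⊤ ∧
      (∫⁻ t in J, ∫⁻ x in U, ENNReal.ofReal (|u x t| ^ p)) < ⊤ ∧
      essSup (fun t => ∫⁻ x, ENNReal.ofReal (|u x t| ^ (p - 1) / (1 + ‖x‖ ^ ((N : ℝ) + s * p))))
        (volume.restrict J) < ⊤ ∧
      (∀ t₀ ∈ I, Tendsto (fun t => ∫ x in U, (u x t - u x t₀) ^ 2)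
          (nhdsWithin t₀ I) (nhds 0))) ∧
  (∀ φ : Euc N × ℝ → ℝ, ContDiff ℝ (⊤ : ℕ∞) φ → HasCompactSupport φ →
    tsupport φ ⊆ Ω ×ˢ interior I →
    -(∫ t in I, ∫ x in Ω, u x t * deriv (fun τ => φ (x, τ)) t) +
      (1 / 2) * ∫ t in I, ∫ x, ∫ y,
        Jp p (u x t - u y t) * (φ (x, t) - φ (y, t)) * K (x - y) = 0)

/-- Essential supremum of `|u|` over a space-time set. -/
def supAbs (N : ℕ) (u : Euc N → ℝ → ℝ) (Q : Set (Euc N × ℝ)) : ℝ≥0∞ :=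
  essSup (fun q : Euc N × ℝ => ENNReal.ofReal |u q.1 q.2|) (volume.restrict Q)

/-- The nonlocal tail `Tail(w; x₀, r)`. -/
def tailFn (N : ℕ) (p s : ℝ) (w : Euc N → ℝ) (x₀ : Euc N) (r : ℝ) : ℝ :=
  (r ^ (s * p) *
    ∫ x in (ball x₀ r)ᶜ, |w x| ^ (p - 1) * ‖x - x₀‖ ^ (-((N : ℝ) + s * p))) ^ (1 / (p - 1))

/-- The parabolic tail `Tail_∞(u; x₀, r, J)`. -/
def tailSup (N : ℕ) (p s : ℝ) (u : Euc N → ℝ → ℝ) (x₀ : Euc N) (r : ℝ) (J : Set ℝ) : ℝ≥0∞ :=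
  essSup (fun t => ENNReal.ofReal (tailFn N p s (fun x => u x t) x₀ r)) (volume.restrict J)

/-- `M_R = ‖u‖_{L^∞(Q_{2R,2R^{sp}}(x₀,t₀))} + Tail_∞(u; x₀, R, (t₀-2R^{sp},t₀]) + 1`. -/
def MR (N : ℕ) (p s : ℝ) (u : Euc N → ℝ → ℝ) (x₀ : Euc N) (R t₀ : ℝ) : ℝ≥0∞ :=
  supAbs N u (ball x₀ (2 * R) ×ˢ Ioc (t₀ - 2 * R ^ (s * p)) t₀)
    + tailSup N p s u x₀ R (Ioc (t₀ - 2 * R ^ (s * p)) t₀) + 1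

/-- `φ ∈ C²ₓ ∩ C¹ₜ(U × I)` with derivative data `Dφ, D2φ, φt`. -/
def C2xC1t (N : ℕ) (U : Set (Euc N)) (I : Set ℝ) (φ : Euc N → ℝ → ℝ)
    (Dφ : Euc N → ℝ → (Euc N →L[ℝ] ℝ)) (D2φ : Euc N → ℝ → (Euc N →L[ℝ] Euc N →L[ℝ] ℝ))
    (φt : Euc N → ℝ → ℝ) : Prop :=
  ContinuousOn (fun q : Euc N × ℝ => φ q.1 q.2) (U ×ˢ I) ∧
  (∀ x ∈ U, ∀ t ∈ I, HasFDerivAt (fun y => φ y t) (Dφ x t) x) ∧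
  ContinuousOn (fun q : Euc N × ℝ => Dφ q.1 q.2) (U ×ˢ I) ∧
  (∀ x ∈ U, ∀ t ∈ I, HasFDerivAt (fun y => Dφ y t) (D2φ x t) x) ∧
  ContinuousOn (fun q : Euc N × ℝ => D2φ q.1 q.2) (U ×ˢ I) ∧
  (∀ x ∈ U, ∀ t ∈ I, HasDerivWithinAt (fun τ => φ x τ) (φt x t) I t) ∧
  ContinuousOn (fun q : Euc N × ℝ => φt q.1 q.2) (U ×ˢ I)

/-- The truncated integral over the annulus `δ < |x - y| < ρ`. -/
def pvIntegral (N : ℕ) (p ρ : ℝ) (K : Euc N → ℝ) (w : Euc N → ℝ) (x : Euc N) (δ : ℝ) : ℝ :=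
  ∫ y in {y : Euc N | δ < dist y x ∧ dist y x < ρ}, Jp p (w x - w y) * K (x - y)

/-- Existence of the principal value `L_K^{B_ρ} w (x) = l`. -/
def HasPV (N : ℕ) (p ρ : ℝ) (K : Euc N → ℝ) (w : Euc N → ℝ) (x : Euc N) (l : ℝ) : Prop :=
  Tendsto (fun δ => pvIntegral N p ρ K w x δ) (nhdsWithin 0 (Ioi 0)) (nhds l)

/-- Weak supersolution of `∂ₜ w + L_K^{B_ρ} w = f` in `U × I`. -/
def IsTruncSuper (N : ℕ) (p ρ : ℝ) (K : Euc N → ℝ) (U : Set (Euc N)) (I : Set ℝ)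
    (f w : Euc N → ℝ → ℝ) : Prop :=
  ∀ φ : Euc N × ℝ → ℝ, ContDiff ℝ (⊤ : ℕ∞) φ → HasCompactSupport φ →
    tsupport φ ⊆ U ×ˢ interior I → (∀ q, 0 ≤ φ q) →
    ∫ t in I, ∫ x in U, f x t * φ (x, t) ≤
      -(∫ t in I, ∫ x in U, w x t * deriv (fun τ => φ (x, τ)) t) +
        (1 / 2) * ∫ t in I, ∫ q in {q : Euc N × Euc N | dist q.1 q.2 < ρ},
          Jp p (w q.1 t - w q.2 t) * (φ (q.1, t) - φ (q.2, t)) * K (q.1 - q.2)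

/-- Weak subsolution of `∂ₜ w + L_K^{B_ρ} w = f` in `U × I`. -/
def IsTruncSub (N : ℕ) (p ρ : ℝ) (K : Euc N → ℝ) (U : Set (Euc N)) (I : Set ℝ)
    (f w : Euc N → ℝ → ℝ) : Prop :=
  ∀ φ : Euc N × ℝ → ℝ, ContDiff ℝ (⊤ : ℕ∞) φ → HasCompactSupport φ →
    tsupport φ ⊆ U ×ˢ interior I → (∀ q, 0 ≤ φ q) →
    -(∫ t in I, ∫ x in U, w x t * deriv (fun τ => φ (x, τ)) t) +
        (1 / 2) * ∫ t in I, ∫ q in {q : Euc N × Euc N | dist q.1 q.2 < ρ},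
          Jp p (w q.1 t - w q.2 t) * (φ (q.1, t) - φ (q.2, t)) * K (q.1 - q.2) ≤
      ∫ t in I, ∫ x in U, f x t * φ (x, t)


lemma Jp_neg (p t : ℝ) : Jp p (-t) = -Jp p t := by
  simp [Jp]

lemma Jp_sub_comm (p a b : ℝ) : Jp p (a - b) = -Jp p (b - a) := by
  rw [← Jp_neg, neg_sub]

lemma measurable_Jp (p : ℝ) : Measurable (Jp p) := by
  unfold Jp
  fun_prop

lemma abs_Jp {p : ℝ} (hp : 1 < p) (t : ℝ) : |Jp p t| = |t| ^ (p - 1) := by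
  unfold Jp
  rw [abs_mul, abs_of_nonneg (Real.rpow_nonneg (abs_nonneg t) _)]
  rcases eq_or_ne t 0 with rfl | h
  · simp [Real.zero_rpow (by linarith : p - 1 ≠ 0)]
  · have : p - 1 = (p - 2) + 1 := by ring
    rw [this, Real.rpow_add_one (abs_pos.mpr h).ne']

lemma Jp_of_nonneg {p : ℝ} (hp : 1 < p) {t : ℝ} (ht : 0 ≤ t) : Jp p t = t ^ (p - 1) := by
  have h := abs_Jp hp t
  rwa [abs_of_nonneg ht, abs_of_nonneg] at h
  unfold Jp; positivity

lemma Jp_mul {p : ℝ} (a b : ℝ) : Jp p (a * b) = Jp p a * Jp p b := by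
  unfold Jp
  rw [abs_mul, Real.mul_rpow (abs_nonneg _) (abs_nonneg _)]; ring

lemma abs_Jp_sub_one_le {p : ℝ} (hp : 1 < p) (hp2 : p < 2) (τ : ℝ) :
    |Jp p τ - 1| ≤ 2 * |τ - 1| := by
  rcases le_total 0 τ with h | h
  · rw [Jp_of_nonneg hp h]
    rcases le_total 1 τ with h1 | h1
    · have h2 : 1 ≤ τ ^ (p - 1) := Real.one_le_rpow h1 (by linarith)
      have h3 : τ ^ (p - 1) ≤ τ ^ (1 : ℝ) := Real.rpow_le_rpow_of_exponent_le h1 (by linarith)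
      rw [Real.rpow_one] at h3
      rw [abs_of_nonneg (by linarith), abs_of_nonneg (by linarith)]; linarith
    · have h2 : τ ^ (p - 1) ≤ 1 := Real.rpow_le_one h h1 (by linarith)
      have h3 : τ ≤ τ ^ (p - 1) := by
        rcases eq_or_lt_of_le h with h0 | h0
        · rw [← h0]; exact Real.rpow_nonneg le_rfl _
        · have := Real.rpow_le_rpow_of_exponent_ge h0 h1 (by linarith : p - 1 ≤ 1)
          rwa [Real.rpow_one] at this
      rw [abs_of_nonpos (by linarith), abs_of_nonpos (by linarith)]; linarith
  · have e : Jp p τ = -((-τ) ^ (p - 1)) := by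
      rw [← Jp_of_nonneg hp (by linarith : 0 ≤ -τ), Jp_neg, neg_neg]
    have h0 : 0 ≤ (-τ) ^ (p - 1) := Real.rpow_nonneg (by linarith) _
    have h4 : (-τ) ^ (p - 1) ≤ 1 + (-τ) := by
      rcases le_total 1 (-τ) with h1 | h1
      · have h3 := Real.rpow_le_rpow_of_exponent_le h1 (by linarith : p - 1 ≤ 1)
        rw [Real.rpow_one] at h3; linarith
      · have := Real.rpow_le_one (by linarith : 0 ≤ -τ) h1 (by linarith : 0 ≤ p - 1); linarith
    rw [e, abs_of_nonpos (by linarith), abs_of_nonpos (by linarith)]; linarith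

lemma abs_Jp_sub_le_of_lt_two {p : ℝ} (hp : 1 < p) (hp2 : p < 2) (a : ℝ) {l : ℝ} (hl : l ≠ 0) :
    |Jp p a - Jp p l| ≤ 2 * |l| ^ (p - 2) * |a - l| := by
  have e1 : Jp p a = Jp p l * Jp p (a / l) := by
    rw [← Jp_mul]; congr 1; field_simp
  have e2 : Jp p a - Jp p l = Jp p l * (Jp p (a / l) - 1) := by rw [e1]; ring
  have h := abs_Jp_sub_one_le hp hp2 (a / l)
  have e3 : |a - l| = |l| * |a / l - 1| := by
    rw [← abs_mul]; congr 1; field_simp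
  have e4 : |Jp p l| = |l| ^ (p - 2) * |l| := by
    unfold Jp
    rw [abs_mul, abs_of_nonneg (Real.rpow_nonneg (abs_nonneg _) _)]
  rw [e2, abs_mul, e3, e4]
  calc |l| ^ (p - 2) * |l| * |Jp p (a / l) - 1| ≤ |l| ^ (p - 2) * |l| * (2 * |a / l - 1|) := by
        gcongr
    _ = _ := by ring

lemma rpow_sub_le {q M a b : ℝ} (hq : 1 ≤ q) (ha : a ∈ Icc 0 M) (hb : b ∈ Icc 0 M) :
    |a ^ q - b ^ q| ≤ q * M ^ (q - 1) * |a - b| := by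
  have := Convex.norm_image_sub_le_of_norm_hasDerivWithin_le (f := fun x : ℝ => x ^ q)
    (f' := fun x => q * x ^ (q - 1)) (s := Icc 0 M) (C := q * M ^ (q - 1)) (x := b) (y := a)
    (fun x _ => (Real.hasDerivAt_rpow_const (Or.inr hq)).hasDerivWithinAt)
    (fun x hx => by
      have h1 : 0 ≤ x ^ (q - 1) := Real.rpow_nonneg hx.1 _
      rw [Real.norm_eq_abs, abs_of_nonneg (by positivity)]
      have := Real.rpow_le_rpow hx.1 hx.2 (by linarith : 0 ≤ q - 1)
      gcongr) (convex_Icc 0 M) hb ha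
  simpa [Real.norm_eq_abs] using this

lemma abs_Jp_sub_le_of_two_le {p M a b : ℝ} (hp2 : 2 ≤ p) (ha : |a| ≤ M) (hb : |b| ≤ M) :
    |Jp p a - Jp p b| ≤ (p - 1) * M ^ (p - 2) * |a - b| := by
  have hp : 1 < p := by linarith
  have key : ∀ a b : ℝ, |a| ≤ M → |b| ≤ M → 0 ≤ a →
      |Jp p a - Jp p b| ≤ (p - 1) * M ^ (p - 2) * |a - b| := by
    intro a b ha hb h0
    rw [abs_of_nonneg h0] at ha
    have hM : 0 ≤ M := h0.trans ha
    have hr := fun {u v} hu hv => rpow_sub_le (q := p - 1) (M := M) (a := u) (b := v)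
      (by linarith) hu hv
    have e : p - 1 - 1 = p - 2 := by ring
    rw [e] at hr
    rcases le_total 0 b with h | h
    · rw [Jp_of_nonneg hp h0, Jp_of_nonneg hp h]
      rw [abs_of_nonneg h] at hb
      exact hr ⟨h0, ha⟩ ⟨h, hb⟩
    · rw [abs_of_nonpos h] at hb
      have e : Jp p b = -((-b) ^ (p - 1)) := by
        rw [← Jp_of_nonneg hp (by linarith : 0 ≤ -b), Jp_neg, neg_neg]
      have z : (0:ℝ) ^ (p - 1) = 0 := Real.zero_rpow (by linarith)
      have h1 := hr (u := a) (v := 0) ⟨h0, ha⟩ ⟨le_rfl, hM⟩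
      have h2 := hr (u := -b) (v := 0) ⟨by linarith, hb⟩ ⟨le_rfl, hM⟩
      rw [z, sub_zero, sub_zero] at h1 h2
      rw [Jp_of_nonneg hp h0, e, sub_neg_eq_add]
      refine (abs_add_le _ _).trans ((add_le_add h1 h2).trans (le_of_eq ?_))
      rw [abs_of_nonneg h0, abs_of_nonneg (by linarith : 0 ≤ -b),
        abs_of_nonneg (by linarith : 0 ≤ a - b)]; ring
  rcases le_total 0 a with h | h
  · exact key a b ha hb h
  · have := key (-a) (-b) (by simpa using ha) (by simpa using hb) (by linarith)
    rw [Jp_neg, Jp_neg] at this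
    have e1 : -Jp p a - -Jp p b = -(Jp p a - Jp p b) := by ring
    have e2 : -a - -b = -(a - b) := by ring
    rwa [e1, e2, abs_neg, abs_neg] at this

/-- Unified difference bound for `J_p`. -/
lemma abs_Jp_sub_le {p : ℝ} (hp : 1 < p) {M r a l : ℝ} (hM : 0 < M) (hr : 0 < r)
    (ha : |a| ≤ M * r) (hl : |l| ≤ M * r) (hl0 : l ≠ 0) (hal : |a - l| ≤ M * r ^ 2) :
    |Jp p a - Jp p l| ≤ (2 * M + (p - 1) * M ^ (p - 2) * M) *
      (|l| ^ (-(max 0 (2 - p))) * r ^ (p + max 0 (2 - p))) := by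
  have hl' : 0 < |l| := abs_pos.mpr hl0
  have hp1 : 0 < p - 1 := by linarith
  rcases lt_or_ge p 2 with h | h
  · rw [max_eq_right (by linarith)]
    have e1 : -(2 - p) = p - 2 := by ring
    have e2 : p + (2 - p) = (2 : ℕ) := by push_cast; ring
    rw [e1, e2, Real.rpow_natCast]
    refine (abs_Jp_sub_le_of_lt_two hp h a hl0).trans ?_
    calc 2 * |l| ^ (p - 2) * |a - l| ≤ 2 * |l| ^ (p - 2) * (M * r ^ 2) := by gcongr
      _ = (2 * M + 0) * (|l| ^ (p - 2) * r ^ 2) := by ring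
      _ ≤ _ := by gcongr; positivity
  · rw [max_eq_left (by linarith)]
    have e2 : r ^ (p + 0) = r ^ (p - 2) * r ^ 2 := by
      rw [← Real.rpow_natCast, ← Real.rpow_add hr]; congr 1; push_cast; ring
    rw [e2, neg_zero, Real.rpow_zero, one_mul]
    refine (abs_Jp_sub_le_of_two_le h ha hl).trans ?_
    rw [Real.mul_rpow hM.le hr.le]
    calc (p - 1) * (M ^ (p - 2) * r ^ (p - 2)) * |a - l|
        ≤ (p - 1) * (M ^ (p - 2) * r ^ (p - 2)) * (M * r ^ 2) := by gcongr
      _ = (0 + (p - 1) * M ^ (p - 2) * M) * (r ^ (p - 2) * r ^ 2) := by ring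
      _ ≤ _ := by gcongr; positivity

lemma integrable_oneD {c : ℝ} (hc : c < 1) (ρ : ℝ) :
    Integrable ((Ioo (-ρ) ρ).indicator (fun x : ℝ => |x| ^ (-c))) := by
  rw [integrable_indicator_iff measurableSet_Ioo]
  rcases le_or_gt ρ 0 with h | h
  · rw [Ioo_eq_empty (by linarith)]; exact integrableOn_empty
  have h1 : IntervalIntegrable (fun x : ℝ => |x| ^ (-c)) volume 0 ρ := by
    refine (intervalIntegral.intervalIntegrable_rpow' (a := 0) (b := ρ)
      (by linarith : -1 < -c)).congr ?_
    intro x hx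
    rw [uIoc_of_le h.le] at hx
    simp [abs_of_pos hx.1]
  have h2 : IntervalIntegrable (fun x : ℝ => |x| ^ (-c)) volume (-ρ) 0 := by
    have := h1.comp_sub_left 0
    simpa using this.symm
  have h3 := h2.trans h1
  rw [intervalIntegrable_iff_integrableOn_Ioc_of_le (by linarith)] at h3
  exact h3.mono_set Ioo_subset_Ioc_self

/-- product weight -/
def Wt (N : ℕ) (c ρ : ℝ) (u : Euc N) : ℝ :=
  ∏ i, (Ioo (-ρ) ρ).indicator (fun x : ℝ => |x| ^ (-c)) (u i)

lemma integrable_Wt (N : ℕ) {c : ℝ} (hc : c < 1) (ρ : ℝ) : Integrable (Wt N c ρ) := by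
  have h : Integrable (fun x : Fin N → ℝ =>
      ∏ i, (Ioo (-ρ) ρ).indicator (fun x : ℝ => |x| ^ (-c)) (x i)) :=
    Integrable.fintype_prod (μ := fun _ => volume) (fun _ => integrable_oneD hc ρ)
  exact (PiLp.volume_preserving_ofLp (Fin N)).integrable_comp_of_integrable h

lemma ae_functional_ne_zero {N : ℕ} (l : Euc N →L[ℝ] ℝ) (hl : l ≠ 0) : ∀ᵐ h, l h ≠ 0 := by
  have h1 : LinearMap.ker (l : Euc N →ₗ[ℝ] ℝ) ≠ ⊤ := by
    intro h
    apply hl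
    ext x
    have : x ∈ LinearMap.ker (l : Euc N →ₗ[ℝ] ℝ) := by rw [h]; trivial
    simpa using this
  have h2 := Measure.addHaar_submodule (volume : Measure (Euc N)) _ h1
  rw [ae_iff]
  convert h2 using 2
  ext x; simp

lemma ae_coord_ne_zero (N : ℕ) : ∀ᵐ u : Euc N, ∀ i, u i ≠ 0 := by
  rw [ae_all_iff]
  intro i
  have := ae_functional_ne_zero (EuclideanSpace.proj i : Euc N →L[ℝ] ℝ) (by
    intro h
    have := congrArg (fun f => f (EuclideanSpace.single i (1:ℝ))) h
    simp at this)
  simpa using this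

lemma rpow_le_const_mul {r ρ α β : ℝ} (hr : 0 < r) (hρ : r ≤ ρ) (h : β ≤ α) :
    r ^ α ≤ ρ ^ (α - β) * r ^ β := by
  have : r ^ α = r ^ (α - β) * r ^ β := by rw [← Real.rpow_add hr]; congr 1; ring
  rw [this]
  gcongr

lemma coord_bound {N : ℕ} (i0 : Fin N) {κ c ρ : ℝ} (hκc : κ ≤ c) (hc0 : 0 ≤ c)
    (u : Euc N) (hu : ∀ i, u i ≠ 0) (hur : ‖u‖ < ρ) :
    |u i0| ^ (-κ) * ‖u‖ ^ (κ - N * c) ≤ Wt N c ρ u := by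
  have hle : ∀ i, |u i| ≤ ‖u‖ := fun i => by
    simpa using PiLp.norm_apply_le u i
  have hpos : ∀ i, 0 < |u i| := fun i => abs_pos.mpr (hu i)
  have hn : 0 < ‖u‖ := (hpos i0).trans_le (hle i0)
  have hW : Wt N c ρ u = ∏ i, |u i| ^ (-c) := by
    unfold Wt
    refine Finset.prod_congr rfl fun i _ => ?_
    rw [indicator_of_mem]
    exact abs_lt.mp ((hle i).trans_lt hur)
  rw [hW, ← Finset.mul_prod_erase Finset.univ _ (Finset.mem_univ i0)]
  have e : ‖u‖ ^ (κ - N * c) = ‖u‖ ^ (κ - c) * ∏ i ∈ Finset.univ.erase i0, ‖u‖ ^ (-c) := by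
    rw [Finset.prod_const, Finset.card_erase_of_mem (Finset.mem_univ _), Finset.card_univ,
      Fintype.card_fin, ← Real.rpow_natCast, ← Real.rpow_mul hn.le, ← Real.rpow_add hn,
      Nat.cast_sub (by have := i0.pos; omega)]
    congr 1; push_cast; ring
  rw [e, ← mul_assoc]
  have e2 : |u i0| ^ (-c) = |u i0| ^ (-κ) * |u i0| ^ (κ - c) := by
    rw [← Real.rpow_add (hpos i0)]; congr 1; ring
  rw [e2]
  have h1 : ‖u‖ ^ (κ - c) ≤ |u i0| ^ (κ - c) :=
    Real.rpow_le_rpow_of_nonpos (hpos i0) (hle i0) (by linarith)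
  have h2 : ∏ i ∈ Finset.univ.erase i0, ‖u‖ ^ (-c) ≤ ∏ i ∈ Finset.univ.erase i0, |u i| ^ (-c) :=
    Finset.prod_le_prod (fun i _ => by positivity) fun i _ =>
      Real.rpow_le_rpow_of_nonpos (hpos i) (hle i) (by linarith)
  have h3 : 0 ≤ ∏ i ∈ Finset.univ.erase i0, ‖u‖ ^ (-c) := Finset.prod_nonneg fun i _ => by positivity
  gcongr

lemma measurable_wfun {N : ℕ} (l : Euc N →L[ℝ] ℝ) (κ γ : ℝ) :
    Measurable (fun h : Euc N => |l h| ^ (-κ) * ‖h‖ ^ γ) := by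
  fun_prop

/-- The key singular integral bound, uniform in the direction of the functional. -/
lemma exists_singular_bound {N : ℕ} (hN : 1 ≤ N) {κ γ ρ m : ℝ} (hκ0 : 0 ≤ κ) (hκ1 : κ < 1)
    (hγ : κ - γ < N) (hρ : 0 < ρ) (hm : 0 < m) :
    ∃ M, ∀ l : Euc N →L[ℝ] ℝ, m ≤ ‖l‖ →
      IntegrableOn (fun h => |l h| ^ (-κ) * ‖h‖ ^ γ) (ball 0 ρ) ∧
      ∫ h in ball 0 ρ, |l h| ^ (-κ) * ‖h‖ ^ γ ≤ M := by
  set c := max κ ((κ - γ) / N) with hc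
  have hN0 : (0:ℝ) < N := by exact_mod_cast hN
  have hc1 : c < 1 := max_lt hκ1 (by rw [div_lt_one hN0]; exact hγ)
  have hκc : κ ≤ c := le_max_left _ _
  have hNc : κ - N * c ≤ γ := by
    have : (κ - γ) / N ≤ c := le_max_right _ _
    rw [div_le_iff₀ hN0] at this; linarith
  let i0 : Fin N := ⟨0, hN⟩
  set A := m ^ (-κ) * ρ ^ (γ - (κ - N * c)) with hA
  have hA0 : 0 ≤ A := by positivity
  refine ⟨∫ u, A * Wt N c ρ u, fun l hl => ?_⟩
  have hl0 : 0 < ‖l‖ := hm.trans_le hl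
  -- the unit vector
  set v := (InnerProductSpace.toDual ℝ (Euc N)).symm l with hv
  have hvn : ‖v‖ = ‖l‖ := by simp [hv]
  have hlv : ∀ h, l h = inner ℝ v h := fun h => by simp [hv]
  set e := (‖v‖)⁻¹ • v with he
  have hen : ‖e‖ = 1 := by
    rw [he, norm_smul, norm_inv, norm_norm, inv_mul_cancel₀]; rw [hvn]; exact hl0.ne'
  have hle : ∀ h, l h = ‖l‖ * inner ℝ e h := fun h => by
    rw [he, real_inner_smul_left, hlv, hvn]; field_simp
  obtain ⟨b, hb⟩ := Orthonormal.exists_orthonormalBasis_extension_of_card_eq (𝕜 := ℝ)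
    (E := Euc N) (ι := Fin N) (by simp) (v := fun _ => e) (s := {i0}) (by
      rw [orthonormal_iff_ite]
      rintro ⟨i, hi⟩ ⟨j, hj⟩
      have : i = i0 := hi
      have : j = i0 := hj
      subst i; subst j
      simp [hen])
  have hb0 : b i0 = e := hb i0 rfl
  have hmp := b.measurePreserving_repr
  have hWi : Integrable (fun h => A * Wt N c ρ (b.repr h)) :=
    hmp.integrable_comp_of_integrable ((integrable_Wt N hc1 ρ).const_mul A)
  have hae : ∀ᵐ h : Euc N, ∀ i, b.repr h i ≠ 0 :=
    hmp.quasiMeasurePreserving.ae (ae_coord_ne_zero N)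
  have hpt : ∀ᵐ h ∂(volume.restrict (ball (0 : Euc N) ρ)),
      |l h| ^ (-κ) * ‖h‖ ^ γ ≤ A * Wt N c ρ (b.repr h) := by
    filter_upwards [ae_restrict_of_ae hae, ae_restrict_mem measurableSet_ball] with h hh hb'
    have hr : ‖h‖ < ρ := by simpa using hb'
    have hcb := coord_bound i0 hκc (hκ0.trans hκc) (b.repr h) hh (by simpa using hr)
    have e1 : b.repr h i0 = inner ℝ e h := by rw [b.repr_apply_apply, hb0]
    have hne : 0 < |inner ℝ e h| := by rw [← e1]; exact abs_pos.mpr (hh i0)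
    rw [LinearIsometryEquiv.norm_map, e1] at hcb
    have hh0 : 0 < ‖h‖ := by
      rw [norm_pos_iff]; rintro rfl; simp at hne
    have h1 : |l h| ^ (-κ) ≤ m ^ (-κ) * |inner ℝ e h| ^ (-κ) := by
      rw [← Real.mul_rpow hm.le hne.le]
      refine Real.rpow_le_rpow_of_nonpos (by positivity) ?_ (by linarith)
      rw [hle, abs_mul, abs_norm]; gcongr
    have h2 := rpow_le_const_mul hh0 hr.le hNc
    calc |l h| ^ (-κ) * ‖h‖ ^ γ ≤ (m ^ (-κ) * |inner ℝ e h| ^ (-κ)) *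
          (ρ ^ (γ - (κ - N * c)) * ‖h‖ ^ (κ - N * c)) := by gcongr
      _ = A * (|inner ℝ e h| ^ (-κ) * ‖h‖ ^ (κ - N * c)) := by rw [hA]; ring
      _ ≤ _ := by gcongr
  have hnn : ∀ h, 0 ≤ |l h| ^ (-κ) * ‖h‖ ^ γ := fun h => by positivity
  have hWnn : ∀ u, 0 ≤ A * Wt N c ρ u := fun u =>
    mul_nonneg hA0 (Finset.prod_nonneg fun i _ => indicator_nonneg (fun x _ => by positivity) _)
  have hsing : IntegrableOn (fun h => |l h| ^ (-κ) * ‖h‖ ^ γ) (ball 0 ρ) := by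
    refine Integrable.mono' hWi.integrableOn (measurable_wfun l κ γ).aestronglyMeasurable ?_
    filter_upwards [hpt] with h hh
    rwa [Real.norm_eq_abs, abs_of_nonneg (hnn h)]
  refine ⟨hsing, ?_⟩
  calc ∫ h in ball 0 ρ, |l h| ^ (-κ) * ‖h‖ ^ γ
      ≤ ∫ h in ball 0 ρ, A * Wt N c ρ (b.repr h) := integral_mono_ae hsing hWi.integrableOn hpt
    _ ≤ ∫ h, A * Wt N c ρ (b.repr h) :=
        setIntegral_le_integral hWi (Eventually.of_forall fun h => hWnn _)
    _ = ∫ u, A * Wt N c ρ u := 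
        hmp.integral_comp b.repr.toHomeomorph.measurableEmbedding (fun u => A * Wt N c ρ u)

lemma integrableOn_norm_rpow {N : ℕ} (hN : 1 ≤ N) {γ ρ : ℝ} (hγ : -γ < N) (hρ : 0 < ρ) :
    IntegrableOn (fun h : Euc N => ‖h‖ ^ γ) (ball 0 ρ) := by
  have hne : (EuclideanSpace.proj (⟨0, hN⟩ : Fin N) : Euc N →L[ℝ] ℝ) ≠ 0 := by
    intro h
    have := congrArg (fun f => f (EuclideanSpace.single (⟨0, hN⟩ : Fin N) (1:ℝ))) h
    simp at this
  obtain ⟨M, hM⟩ := exists_singular_bound hN (κ := 0) (γ := γ) le_rfl (by norm_num) (by linarith)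
    hρ (norm_pos_iff.mpr hne)
  simpa using (hM _ le_rfl).1

lemma K_bound_of_le {N : ℕ} {p s Lam : ℝ} (hp : 1 < p) (hs : s ∈ Ioo (0 : ℝ) 1) (hLam : 0 < Lam)
    {K : Euc N → ℝ} (hKpos : ∀ z : Euc N, z ≠ 0 → 0 < K z)
    (hKub : ∀ z : Euc N, z ≠ 0 → K z ≤ Lam * ‖z‖ ^ (-((N : ℝ) + s * p)))
    {δ : ℝ} (hδ : 0 < δ) {z : Euc N} (hz : δ ≤ ‖z‖) :
    |K z| ≤ Lam * δ ^ (-((N : ℝ) + s * p)) := by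
  have hz0 : z ≠ 0 := norm_pos_iff.mp (hδ.trans_le hz)
  rw [abs_of_pos (hKpos z hz0)]
  refine (hKub z hz0).trans ?_
  have hsp : 0 < s * p := mul_pos hs.1 (by linarith)
  have : ‖z‖ ^ (-((N : ℝ) + s * p)) ≤ δ ^ (-((N : ℝ) + s * p)) :=
    Real.rpow_le_rpow_of_nonpos hδ hz (by
      have : (0:ℝ) ≤ N := Nat.cast_nonneg N
      linarith)
  gcongr

lemma exists_pv_bound {N : ℕ} (hN : 1 ≤ N) {p s Lam : ℝ}
    (hp : 1 < p) (hs : s ∈ Ioo (0 : ℝ) 1) (hLam : 0 < Lam)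
    {K : Euc N → ℝ}
    (hKm : Measurable K) (hKpos : ∀ z : Euc N, z ≠ 0 → 0 < K z)
    (hKsymm : ∀ z : Euc N, z ≠ 0 → K (-z) = K z)
    (hKub : ∀ z : Euc N, z ≠ 0 → K z ≤ Lam * ‖z‖ ^ (-((N : ℝ) + s * p)))
    {ρ m B : ℝ} (hρ : 0 < ρ) (hm : 0 < m) (hB : 0 < B) :
    ∃ M, ∀ (w : Euc N → ℝ) (x : Euc N) (l : Euc N →L[ℝ] ℝ), ContinuousOn w (ball x ρ) →
      m ≤ ‖l‖ → ‖l‖ ≤ B →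
      (∀ h, ‖h‖ < ρ → |w x - w (x + h)| ≤ B * ‖h‖) →
      (∀ h, ‖h‖ < ρ → |w x - w (x + h) - (-(l h))| ≤ B * ‖h‖ ^ 2) →
      ∀ δ, 0 < δ → |pvIntegral N p ρ K w x δ| ≤ M := by
  set κ := max 0 (2 - p) with hκ
  set γ := p + κ - (N + s * p) with hγ
  obtain ⟨M, hM⟩ := exists_singular_bound hN (κ := κ) (γ := γ) (ρ := ρ) (m := m)
    (le_max_left _ _) (max_lt (by norm_num) (by linarith)) (by
      rw [hγ]; nlinarith [hs.1, hs.2]) hρ hm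
  set C := 2 * B + (p - 1) * B ^ (p - 2) * B with hC
  have hC0 : 0 ≤ C := by
    have : 0 < p - 1 := by linarith
    positivity
  refine ⟨C * Lam * M, fun w x l hw hml hlB h1 h2 δ hδ => ?_⟩
  obtain ⟨hsing, hMl⟩ := hM l hml
  set A : Set (Euc N) := {h | δ < ‖h‖ ∧ ‖h‖ < ρ} with hA
  have hAm : MeasurableSet A :=
    (measurableSet_lt measurable_const measurable_norm).inter
      (measurableSet_lt measurable_norm measurable_const)
  have hAb : A ⊆ ball 0 ρ := fun h hh => by simpa using hh.2
  have hAfin : volume A ≠ ⊤ := (measure_mono hAb |>.trans_lt measure_ball_lt_top).ne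
  -- translate
  have htr : pvIntegral N p ρ K w x δ = ∫ h in A, Jp p (w x - w (x + h)) * K (-h) := by
    unfold pvIntegral
    have hAx : MeasurableSet {y : Euc N | δ < dist y x ∧ dist y x < ρ} :=
      (measurableSet_lt measurable_const (measurable_id.dist measurable_const)).inter
      (measurableSet_lt (measurable_id.dist measurable_const) measurable_const)
    rw [← integral_indicator hAx, ← integral_indicator hAm, ← integral_add_left_eq_self _ x]
    congr 1
    ext h
    simp only [indicator, mem_ofPred_eq, hA, dist_self_add_left]
    simp
  -- first integrand
  have hsp : 0 < s * p := mul_pos hs.1 (by linarith)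
  have hJb : ∀ a : ℝ, |a| ≤ B * ρ → |Jp p a| ≤ (B * ρ) ^ (p - 1) := fun a ha => by
    rw [abs_Jp hp]; exact Real.rpow_le_rpow (abs_nonneg _) ha (by linarith)
  have hKb : ∀ h ∈ A, |K (-h)| ≤ Lam * δ ^ (-((N : ℝ) + s * p)) := fun h hh =>
    K_bound_of_le hp hs hLam hKpos hKub hδ (by rw [norm_neg]; exact hh.1.le)
  have hbd : ∀ f : Euc N → ℝ, AEMeasurable f (volume.restrict A) →
      (∀ h ∈ A, |f h| ≤ B * ρ) → IntegrableOn (fun h => Jp p (f h) * K (-h)) A := by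
    intro f hf hfb
    have : IsFiniteMeasure (volume.restrict A) := isFiniteMeasure_restrict.mpr hAfin
    refine Integrable.of_bound (C := (B * ρ) ^ (p - 1) * (Lam * δ ^ (-((N : ℝ) + s * p)))) ?_ ?_
    · exact (((measurable_Jp p).comp_aemeasurable hf).mul
        (hKm.comp measurable_neg).aemeasurable).aestronglyMeasurable
    · filter_upwards [ae_restrict_mem hAm] with h hh
      rw [norm_mul, Real.norm_eq_abs, Real.norm_eq_abs]
      exact mul_le_mul (hJb _ (hfb h hh)) (hKb h hh) (abs_nonneg _) (by positivity)
  have hlh : ∀ h, |-(l h)| ≤ B * ‖h‖ := fun h => by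
    rw [abs_neg]
    exact (l.le_opNorm h).trans (by gcongr)
  have i1 : IntegrableOn (fun h => Jp p (w x - w (x + h)) * K (-h)) A := by
    refine hbd _ ?_ ?_
    · refine AEMeasurable.const_sub ?_ _
      refine ContinuousOn.aemeasurable ?_ hAm
      refine hw.comp (by fun_prop) ?_
      intro h hh
      simpa using hh.2
    · intro h hh
      refine (h1 h hh.2).trans ?_
      have := hh.2.le
      gcongr
  have i2 : IntegrableOn (fun h => Jp p (-(l h)) * K (-h)) A := by
    refine hbd _ (by fun_prop) ?_
    intro h hh
    refine (hlh h).trans ?_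
    have := hh.2.le
    gcongr
  have hz : ∫ h in A, Jp p (-(l h)) * K (-h) = 0 := by
    rw [← integral_indicator hAm]
    set g := A.indicator (fun h => Jp p (-(l h)) * K (-h)) with hg
    have hodd : ∀ h, g (-h) = -g h := by
      intro h
      by_cases hh : h ∈ A
      · have hh' : -h ∈ A := by simpa [hA] using hh
        have h0 : h ≠ 0 := norm_pos_iff.mp (hδ.trans hh.1)
        rw [hg, indicator_of_mem hh, indicator_of_mem hh', map_neg, neg_neg, neg_neg, hKsymm h h0,
          Jp_neg]
        ring
      · have hh' : -h ∉ A := by simpa [hA] using hh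
        rw [hg, indicator_of_notMem hh, indicator_of_notMem hh', neg_zero]
    have := integral_neg_eq_self g volume
    simp_rw [hodd, integral_neg] at this
    linarith
  rw [htr]
  have hsub : ∫ h in A, Jp p (w x - w (x + h)) * K (-h) =
      ∫ h in A, (Jp p (w x - w (x + h)) * K (-h) - Jp p (-(l h)) * K (-h)) := by
    rw [integral_sub i1 i2, hz, sub_zero]
  have hl0 : l ≠ 0 := norm_pos_iff.mp (hm.trans_le hml)
  have hnn : ∀ h, 0 ≤ |l h| ^ (-κ) * ‖h‖ ^ γ := fun h => by positivity
  rw [hsub, ← Real.norm_eq_abs]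
  calc ‖∫ h in A, (Jp p (w x - w (x + h)) * K (-h) - Jp p (-(l h)) * K (-h))‖
      ≤ ∫ h in A, C * Lam * (|l h| ^ (-κ) * ‖h‖ ^ γ) := by
        refine norm_integral_le_of_norm_le ((hsing.mono_set hAb).const_mul _) ?_
        filter_upwards [ae_restrict_mem hAm, ae_restrict_of_ae (ae_functional_ne_zero l hl0)]
          with h hh hne
        have hr : 0 < ‖h‖ := hδ.trans hh.1
        have h0 : -h ≠ 0 := neg_ne_zero.mpr (norm_pos_iff.mp hr)
        have hJ := abs_Jp_sub_le hp hB hr (h1 h hh.2) (hlh h) (neg_ne_zero.mpr hne) (h2 h hh.2)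
        have hK := hKub (-h) h0
        rw [norm_neg] at hK
        rw [← sub_mul, norm_mul, Real.norm_eq_abs, Real.norm_eq_abs, abs_of_pos (hKpos _ h0)]
        rw [abs_neg] at hJ
        calc _ ≤ (C * (|l h| ^ (-κ) * ‖h‖ ^ (p + κ))) * (Lam * ‖h‖ ^ (-((N : ℝ) + s * p))) :=
              mul_le_mul hJ hK (hKpos _ h0).le (by positivity)
          _ = C * Lam * (|l h| ^ (-κ) * (‖h‖ ^ (p + κ) * ‖h‖ ^ (-((N : ℝ) + s * p)))) := by ring
          _ = _ := by rw [← Real.rpow_add hr, hγ]; rfl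
    _ = C * Lam * ∫ h in A, |l h| ^ (-κ) * ‖h‖ ^ γ := integral_const_mul _ _
    _ ≤ C * Lam * M := by
        refine mul_le_mul_of_nonneg_left ?_ (by positivity)
        refine le_trans (setIntegral_mono_set hsing (Eventually.of_forall hnn) ?_) hMl
        exact Eventually.of_forall hAb

lemma measurableSet_S {N : ℕ} {U : Set (Euc N)} (hU : IsOpen U) (ρ : ℝ) :
    MeasurableSet {q : Euc N × Euc N | q.1 ∈ U ∧ q.2 ∈ U ∧ dist q.1 q.2 < ρ} :=
  (measurable_fst hU.measurableSet).inter ((measurable_snd hU.measurableSet).inter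
    (measurableSet_lt (measurable_fst.dist measurable_snd) measurable_const))

lemma integrableOn_S_norm_rpow {N : ℕ} (hN : 1 ≤ N) {U : Set (Euc N)} (hU : IsOpen U)
    (hUfin : volume U ≠ ⊤) {γ ρ : ℝ} (hγ : -γ < N) (hρ : 0 < ρ) :
    IntegrableOn (fun q : Euc N × Euc N => ‖q.1 - q.2‖ ^ γ)
      {q : Euc N × Euc N | q.1 ∈ U ∧ q.2 ∈ U ∧ dist q.1 q.2 < ρ} := by
  have h1 : Integrable (U.indicator (fun _ : Euc N => (1:ℝ))) := by
    rw [integrable_indicator_iff hU.measurableSet]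
    exact integrableOn_const hUfin
  have h2 : Integrable ((ball (0 : Euc N) ρ).indicator (fun h : Euc N => ‖h‖ ^ γ)) := by
    rw [integrable_indicator_iff measurableSet_ball]
    exact integrableOn_norm_rpow hN hγ hρ
  have h3 := h1.mul_prod h2
  have h4 := (measurePreserving_prod_sub (volume : Measure (Euc N))
    (volume : Measure (Euc N))).integrable_comp_of_integrable h3
  have h5 : IntegrableOn _ {q : Euc N × Euc N | q.1 ∈ U ∧ q.2 ∈ U ∧ dist q.1 q.2 < ρ}
    (volume : Measure (Euc N × Euc N)) := Integrable.integrableOn h4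
  refine h5.congr_fun ?_ (measurableSet_S hU ρ)
  rintro ⟨x, y⟩ ⟨hx, hy, hd⟩
  simp only at hx hy hd
  have : y - x ∈ ball (0 : Euc N) ρ := by
    rw [mem_ball_zero_iff, ← dist_eq_norm, dist_comm]; exact hd
  simp only [Function.comp]
  rw [indicator_of_mem hx, indicator_of_mem this, one_mul, norm_sub_rev]

lemma integrand_bound {N : ℕ} {p s Lam : ℝ} (hp : 1 < p) (hLam : 0 < Lam)
    {K : Euc N → ℝ} (hKpos : ∀ z : Euc N, z ≠ 0 → 0 < K z)
    (hKub : ∀ z : Euc N, z ≠ 0 → K z ≤ Lam * ‖z‖ ^ (-((N : ℝ) + s * p)))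
    {V : Set (Euc N)} {ρ B L : ℝ} (hB : 0 < B) (hL : 0 ≤ L)
    {w η : Euc N → ℝ}
    (hwL : ∀ x ∈ V, ∀ y, dist x y < ρ → |w x - w y| ≤ B * dist x y)
    (hηV : ∀ x, x ∉ V → η x = 0)
    (hηL : ∀ x y, |η x - η y| ≤ L * dist x y) (x y : Euc N) (hd : dist x y < ρ) :
    |Jp p (w x - w y) * (η x - η y) * K (x - y)| ≤
      (B ^ (p - 1) * L * Lam) * ‖x - y‖ ^ (p - (N + s * p)) := by
  have hnn : 0 ≤ (B ^ (p - 1) * L * Lam) * ‖x - y‖ ^ (p - (N + s * p)) := by positivity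
  rcases eq_or_ne x y with rfl | hxy
  · simpa using hnn
  by_cases hV : x ∈ V ∨ y ∈ V
  · have hw : |w x - w y| ≤ B * ‖x - y‖ := by
      rw [← dist_eq_norm]
      rcases hV with h | h
      · exact hwL x h y hd
      · rw [abs_sub_comm, dist_comm]; exact hwL y h x (by rwa [dist_comm])
    have hxy' : x - y ≠ 0 := sub_ne_zero.mpr hxy
    have hr : 0 < ‖x - y‖ := norm_pos_iff.mpr hxy'
    have hη := hηL x y
    rw [dist_eq_norm] at hη
    rw [abs_mul, abs_mul, abs_Jp hp, abs_of_pos (hKpos _ hxy')]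
    have hJ : |w x - w y| ^ (p - 1) ≤ (B * ‖x - y‖) ^ (p - 1) :=
      Real.rpow_le_rpow (abs_nonneg _) hw (by linarith)
    calc _ ≤ (B * ‖x - y‖) ^ (p - 1) * (L * ‖x - y‖) * (Lam * ‖x - y‖ ^ (-((N : ℝ) + s * p))) :=
          mul_le_mul (mul_le_mul hJ hη (abs_nonneg _) (by positivity)) (hKub _ hxy')
            (hKpos _ hxy').le (by positivity)
      _ = (B ^ (p - 1) * L * Lam) *
          (‖x - y‖ ^ (p - 1) * ‖x - y‖ ^ (1:ℝ) * ‖x - y‖ ^ (-((N : ℝ) + s * p))) := by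
          rw [Real.mul_rpow hB.le hr.le, Real.rpow_one]; ring
      _ = _ := by
          rw [← Real.rpow_add hr, ← Real.rpow_add hr]; congr 2; ring
  · push Not at hV
    rw [hηV x hV.1, hηV y hV.2]
    simpa using hnn

lemma spatial_ineq {N : ℕ} (hN : 1 ≤ N) {p s Lam : ℝ}
    (hp : 1 < p) (hs : s ∈ Ioo (0 : ℝ) 1) (hLam : 0 < Lam)
    {K : Euc N → ℝ}
    (hKm : Measurable K) (hKpos : ∀ z : Euc N, z ≠ 0 → 0 < K z)
    (hKsymm : ∀ z : Euc N, z ≠ 0 → K (-z) = K z)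
    (hKub : ∀ z : Euc N, z ≠ 0 → K z ≤ Lam * ‖z‖ ^ (-((N : ℝ) + s * p)))
    {U V : Set (Euc N)} (hU : IsOpen U) (hUfin : volume U ≠ ⊤) (hVU : V ⊆ U)
    {ρ B L M : ℝ} (hρ : 0 < ρ) (hB : 0 < B) (hL : 0 ≤ L)
    (hρU : ∀ x ∈ V, ball x ρ ⊆ U)
    {w η θ : Euc N → ℝ} (hwc : ContinuousOn w U) (hwB : ∀ x ∈ U, |w x| ≤ B)
    (hwL : ∀ x ∈ V, ∀ y, dist x y < ρ → |w x - w y| ≤ B * dist x y)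
    (hηc : Continuous η) (hηi : Integrable η) {E : ℝ} (hηE : ∀ x, |η x| ≤ E)
    (hη0 : ∀ x, 0 ≤ η x) (hηV : ∀ x, x ∉ V → η x = 0)
    (hηL : ∀ x y, |η x - η y| ≤ L * dist x y)
    (hθ : IntegrableOn (fun x => θ x * η x) U)
    (hM : ∀ x ∈ V, ∀ δ, 0 < δ → |pvIntegral N p ρ K w x δ| ≤ M)
    (hsuper : ∀ x ∈ V, ∃ l : ℝ, HasPV N p ρ K w x l ∧ 0 ≤ θ x + l) :
    0 ≤ (∫ x in U, θ x * η x) +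
      (1 / 2) * ∫ q in {q : Euc N × Euc N | q.1 ∈ U ∧ q.2 ∈ U ∧ dist q.1 q.2 < ρ},
        Jp p (w q.1 - w q.2) * (η q.1 - η q.2) * K (q.1 - q.2) := by
  set S := {q : Euc N × Euc N | q.1 ∈ U ∧ q.2 ∈ U ∧ dist q.1 q.2 < ρ} with hS
  have hSm : MeasurableSet S := measurableSet_S hU ρ
  have hSfin : volume S ≠ ⊤ := by
    refine (lt_of_le_of_lt (measure_mono (t := U ×ˢ U) ?_) ?_).ne
    · rintro q ⟨h1, h2, _⟩; exact ⟨h1, h2⟩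
    · rw [Measure.volume_eq_prod, Measure.prod_prod]
      exact ENNReal.mul_lt_top hUfin.lt_top hUfin.lt_top
  have hE0 : 0 ≤ E := (abs_nonneg _).trans (hηE 0)
  set f0 : Euc N × Euc N → ℝ := fun q => Jp p (w q.1 - w q.2) * (η q.1 - η q.2) * K (q.1 - q.2)
    with hf0
  set f1 : Euc N × Euc N → ℝ := fun q => Jp p (w q.1 - w q.2) * η q.1 * K (q.1 - q.2) with hf1
  set f2 : Euc N × Euc N → ℝ := fun q => Jp p (w q.1 - w q.2) * η q.2 * K (q.1 - q.2) with hf2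
  have hJm : AEMeasurable (fun q : Euc N × Euc N => Jp p (w q.1 - w q.2)) (volume.restrict S) := by
    refine (measurable_Jp p).comp_aemeasurable (ContinuousOn.aemeasurable ?_ hSm)
    refine ContinuousOn.sub (hwc.comp continuousOn_fst ?_) (hwc.comp continuousOn_snd ?_)
    · intro q hq; exact hq.1
    · intro q hq; exact hq.2.1
  have hKm' : Measurable (fun q : Euc N × Euc N => K (q.1 - q.2)) :=
    hKm.comp (measurable_fst.sub measurable_snd)
  have hm0 : AEStronglyMeasurable f0 (volume.restrict S) :=
    ((hJm.mul (by fun_prop)).mul hKm'.aemeasurable).aestronglyMeasurable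
  have hm1 : AEStronglyMeasurable f1 (volume.restrict S) :=
    ((hJm.mul (by fun_prop)).mul hKm'.aemeasurable).aestronglyMeasurable
  have hm2 : AEStronglyMeasurable f2 (volume.restrict S) :=
    ((hJm.mul (by fun_prop)).mul hKm'.aemeasurable).aestronglyMeasurable
  have hgi := integrableOn_S_norm_rpow hN hU hUfin (γ := p - (N + s * p)) (ρ := ρ)
    (by nlinarith [hs.1, hs.2]) hρ
  have hg := hgi.const_mul (B ^ (p - 1) * L * Lam)
  have hb0 : ∀ q ∈ S, |f0 q| ≤ (B ^ (p - 1) * L * Lam) * ‖q.1 - q.2‖ ^ (p - (N + s * p)) :=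
    fun q hq => integrand_bound hp hLam hKpos hKub hB hL hwL hηV hηL q.1 q.2 hq.2.2
  -- truncated sets
  set T : ℝ → Set (Euc N × Euc N) := fun δ => {q | δ < dist q.1 q.2} with hT
  have hTm : ∀ δ, MeasurableSet (T δ) := fun δ =>
    measurableSet_lt measurable_const (measurable_fst.dist measurable_snd)
  have hlim : Tendsto (fun δ => ∫ q in S, (T δ).indicator f0 q) (𝓝[>] 0) (𝓝 (∫ q in S, f0 q)) := by
    refine tendsto_integral_filter_of_dominated_convergence _ ?_ ?_ hg ?_
    · exact Eventually.of_forall fun δ => hm0.indicator (hTm δ)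
    · refine Eventually.of_forall fun δ => ?_
      filter_upwards [ae_restrict_mem hSm] with q hq
      exact (norm_indicator_le_norm_self _ _).trans (hb0 q hq)
    · refine Eventually.of_forall fun q => ?_
      rcases eq_or_ne q.1 q.2 with h | h
      · have : f0 q = 0 := by simp [hf0, h]
        refine tendsto_const_nhds.congr fun δ => ?_
        rw [indicator_apply, this, ite_self]
      · have hpos : 0 < dist q.1 q.2 := dist_pos.mpr h
        refine tendsto_const_nhds.congr' ?_
        filter_upwards [Ioo_mem_nhdsGT hpos] with δ hδ
        rw [indicator_of_mem]; exact hδ.2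
  -- the identity
  have hPδ : ∀ δ, 0 < δ → Integrable (fun x => η x * pvIntegral N p ρ K w x δ) ∧
      (1 / 2) * ∫ q in S, (T δ).indicator f0 q = ∫ x, η x * pvIntegral N p ρ K w x δ := by
    intro δ hδ
    set Sδ := S ∩ T δ with hSδ
    have hSδm : MeasurableSet Sδ := hSm.inter (hTm δ)
    have : IsFiniteMeasure (volume.restrict Sδ) := isFiniteMeasure_restrict.mpr
      (ne_top_of_le_ne_top hSfin (measure_mono inter_subset_left))
    have hJb : ∀ q ∈ Sδ, |Jp p (w q.1 - w q.2)| ≤ (2 * B) ^ (p - 1) := by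
      intro q hq
      rw [abs_Jp hp]
      refine Real.rpow_le_rpow (abs_nonneg _) ?_ (by linarith)
      have h1 := hwB q.1 hq.1.1
      have h2 := hwB q.2 hq.1.2.1
      exact (abs_sub _ _).trans (by linarith)
    have hKb : ∀ q ∈ Sδ, |K (q.1 - q.2)| ≤ Lam * δ ^ (-((N : ℝ) + s * p)) := fun q hq =>
      K_bound_of_le hp hs hLam hKpos hKub hδ (by
        rw [← dist_eq_norm]; exact (le_of_lt hq.2))
    have i1 : IntegrableOn f1 Sδ := by
      refine Integrable.of_bound
        (C := (2 * B) ^ (p - 1) * E * (Lam * δ ^ (-((N : ℝ) + s * p))))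
        (hm1.mono_measure (Measure.restrict_mono inter_subset_left le_rfl)) ?_
      filter_upwards [ae_restrict_mem hSδm] with q hq
      rw [Real.norm_eq_abs, hf1, abs_mul, abs_mul]
      exact mul_le_mul (mul_le_mul (hJb q hq) (hηE _) (abs_nonneg _) (by positivity))
        (hKb q hq) (abs_nonneg _) (by positivity)
    have i2 : IntegrableOn f2 Sδ := by
      refine Integrable.of_bound
        (C := (2 * B) ^ (p - 1) * E * (Lam * δ ^ (-((N : ℝ) + s * p))))
        (hm2.mono_measure (Measure.restrict_mono inter_subset_left le_rfl)) ?_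
      filter_upwards [ae_restrict_mem hSδm] with q hq
      rw [Real.norm_eq_abs, hf2, abs_mul, abs_mul]
      exact mul_le_mul (mul_le_mul (hJb q hq) (hηE _) (abs_nonneg _) (by positivity))
        (hKb q hq) (abs_nonneg _) (by positivity)
    have hswap : ∫ q in Sδ, f2 q = -∫ q in Sδ, f1 q := by
      rw [← integral_indicator hSδm, ← integral_indicator hSδm, ← integral_neg,
        Measure.volume_eq_prod, ← integral_prod_swap]
      congr 1
      ext q
      have hmem : q.swap ∈ Sδ ↔ q ∈ Sδ := by
        simp only [hSδ, hS, hT, mem_inter_iff, mem_ofPred_eq, Prod.fst_swap, Prod.snd_swap,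
          dist_comm q.2 q.1]
        tauto
      by_cases hq : q ∈ Sδ
      · rw [indicator_of_mem (hmem.mpr hq), indicator_of_mem hq]
        have hne : q.1 - q.2 ≠ 0 := by
          rw [sub_ne_zero, ← dist_pos]; exact hδ.trans hq.2
        simp only [hf1, hf2, Prod.fst_swap, Prod.snd_swap]
        rw [Jp_sub_comm, ← hKsymm _ hne, neg_sub]; ring
      · rw [indicator_of_notMem (fun h => hq (hmem.mp h)), indicator_of_notMem hq, neg_zero]
    have hF : (1 / 2) * ∫ q in S, (T δ).indicator f0 q = ∫ q, Sδ.indicator f1 q := by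
      rw [setIntegral_indicator (hTm δ), integral_indicator hSδm]
      have : ∫ q in Sδ, f0 q = ∫ q in Sδ, (f1 q - f2 q) := by
        congr 1; ext q; simp only [hf0, hf1, hf2]; ring
      rw [this, integral_sub i1 i2, hswap]; ring
    have hind : Integrable (Sδ.indicator f1) := (integrable_indicator_iff hSδm).mpr i1
    have hinner : ∀ x, ∫ y, Sδ.indicator f1 (x, y) = η x * pvIntegral N p ρ K w x δ := by
      intro x
      by_cases hx : x ∈ V
      · have hAx : MeasurableSet {y : Euc N | δ < dist y x ∧ dist y x < ρ} :=
          (measurableSet_lt measurable_const (measurable_id.dist measurable_const)).inter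
          (measurableSet_lt (measurable_id.dist measurable_const) measurable_const)
        unfold pvIntegral
        rw [← integral_const_mul, ← integral_indicator hAx]
        congr 1
        ext y
        have hmem : (x, y) ∈ Sδ ↔ y ∈ {y : Euc N | δ < dist y x ∧ dist y x < ρ} := by
          simp only [hSδ, hS, hT, mem_inter_iff, mem_ofPred_eq, dist_comm x y]
          constructor
          · rintro ⟨⟨_, _, h⟩, h'⟩; exact ⟨h', h⟩
          · rintro ⟨h', h⟩; exact ⟨⟨hVU hx, hρU x hx h, h⟩, h'⟩
        by_cases hy : (x, y) ∈ Sδ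
        · rw [indicator_of_mem hy, indicator_of_mem (hmem.mp hy)]; simp only [hf1]; ring
        · rw [indicator_of_notMem hy, indicator_of_notMem (fun h => hy (hmem.mpr h))]
      · have : ∀ y, Sδ.indicator f1 (x, y) = 0 := fun y => by
          rw [indicator_apply]; simp [hf1, hηV x hx]
        simp [this, hηV x hx]
    rw [Measure.volume_eq_prod] at hind
    constructor
    · have := hind.integral_prod_left
      simpa only [hinner] using this
    · rw [hF, Measure.volume_eq_prod, integral_prod _ hind]
      simp only [hinner]
  -- conclusion
  set Θ : Euc N → ℝ := U.indicator (fun x => θ x * η x) with hΘ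
  have hΘi : Integrable Θ := (integrable_indicator_iff hU.measurableSet).mpr hθ
  have hneg : Tendsto (fun δ => ∫ x, min (η x * pvIntegral N p ρ K w x δ + Θ x) 0)
      (𝓝[>] 0) (𝓝 (∫ _x : Euc N, (0:ℝ))) := by
    refine tendsto_integral_filter_of_dominated_convergence (fun x => |η x| * M + |Θ x|) ?_ ?_
      ((hηi.abs.mul_const M).add hΘi.abs) ?_
    · filter_upwards [self_mem_nhdsWithin] with δ hδ
      exact (((hPδ δ hδ).1.add hΘi).inf (integrable_zero _ _ _)).aestronglyMeasurable
    · filter_upwards [self_mem_nhdsWithin] with δ hδ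
      refine Eventually.of_forall fun x => ?_
      have h1 : ‖min (η x * pvIntegral N p ρ K w x δ + Θ x) 0‖ ≤
          |η x * pvIntegral N p ρ K w x δ + Θ x| := by
        rw [Real.norm_eq_abs, abs_of_nonpos (min_le_right _ _)]
        rcases le_total (η x * pvIntegral N p ρ K w x δ + Θ x) 0 with h | h
        · rw [min_eq_left h]; exact neg_le_abs _
        · rw [min_eq_right h]; simp
      refine h1.trans ((abs_add_le _ _).trans ?_)
      gcongr
      by_cases hx : x ∈ V
      · rw [abs_mul]; gcongr; exact hM x hx δ hδ
      · simp [hηV x hx]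
    · refine Eventually.of_forall fun x => ?_
      by_cases hx : x ∈ V
      · obtain ⟨l, hl, hl0⟩ := hsuper x hx
        have h1 : Θ x = θ x * η x := indicator_of_mem (hVU hx) _
        have h2 : min (η x * l + Θ x) 0 = 0 := by
          rw [h1]; apply min_eq_right
          have := mul_nonneg (hη0 x) hl0
          linarith
        have h3 := ((hl.const_mul (η x)).add_const (Θ x)).min (tendsto_const_nhds (x := (0:ℝ)))
        rwa [h2] at h3
      · have h1 : Θ x = 0 := by rw [hΘ, indicator_apply]; simp [hηV x hx]
        simp [h1, hηV x hx]
  rw [integral_zero] at hneg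
  have hlim' := (hlim.const_mul (1 / 2)).const_add (∫ x in U, θ x * η x)
  refine le_of_tendsto_of_tendsto hneg hlim' ?_
  filter_upwards [self_mem_nhdsWithin] with δ hδ
  obtain ⟨hi, he⟩ := hPδ δ hδ
  rw [he, ← integral_indicator hU.measurableSet, add_comm, ← integral_add hi hΘi]
  exact integral_mono ((hi.add hΘi).inf (integrable_zero _ _ _)) (hi.add hΘi)
    fun x => min_le_left _ _

lemma time_parts {N : ℕ} {U V : Set (Euc N)} {I : Set ℝ} (hIb : Bornology.IsBounded I)
    (hIc : I.OrdConnected) (hU : IsOpen U) (hUfin : volume U ≠ ⊤)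
    {φ φt : Euc N → ℝ → ℝ}
    (hφc : ContinuousOn (fun q : Euc N × ℝ => φ q.1 q.2) (U ×ˢ I))
    (hφd : ∀ x ∈ U, ∀ t ∈ I, HasDerivWithinAt (fun τ => φ x τ) (φt x t) I t)
    (hφtc : ContinuousOn (fun q : Euc N × ℝ => φt q.1 q.2) (U ×ˢ I))
    {B : ℝ} (hB : ∀ x ∈ U, ∀ t ∈ I, |φ x t| ≤ B) (hBt : ∀ x ∈ U, ∀ t ∈ I, |φt x t| ≤ B)
    {ψ : Euc N × ℝ → ℝ} (hψ : ContDiff ℝ (⊤ : ℕ∞) ψ) (hψc : HasCompactSupport ψ)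
    (hψs : tsupport ψ ⊆ V ×ˢ interior I) :
    Integrable (fun t => ∫ x in U, φt x t * ψ (x, t)) (volume.restrict I) ∧
    ∫ t in I, ∫ x in U, φ x t * deriv (fun σ => ψ (x, σ)) t =
      -∫ t in I, ∫ x in U, φt x t * ψ (x, t) := by
  have hIm : MeasurableSet I := hIc.measurableSet
  have hIfin : volume I ≠ ⊤ := hIb.measure_lt_top.ne
  have hψdiff : Differentiable ℝ ψ := hψ.differentiable (by simp)
  set D : Euc N × ℝ → ℝ := fun q => fderiv ℝ ψ q (0, 1) with hD
  have hdψ : ∀ x t, HasDerivAt (fun σ => ψ (x, σ)) (D (x, t)) t := by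
    intro x t
    have h1 : HasDerivAt (fun σ : ℝ => (x, σ)) ((0 : Euc N), (1 : ℝ)) t :=
      (hasDerivAt_const t x).prodMk (hasDerivAt_id t)
    exact (hψdiff (x, t)).hasFDerivAt.comp_hasDerivAt t h1
  have hderiv : ∀ x t, deriv (fun σ => ψ (x, σ)) t = D (x, t) := fun x t => (hdψ x t).deriv
  have hDc : Continuous D := (hψ.continuous_fderiv (by simp)).clm_apply continuous_const
  have hDs : HasCompactSupport D := by
    refine (hψc.fderiv (𝕜 := ℝ)).mono ?_
    intro q hq h
    apply hq
    simp only [hD]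
    rw [h]; simp
  have hD0 : ∀ q, q ∉ tsupport ψ → D q = 0 := by
    intro q hq
    have : fderiv ℝ ψ q = 0 := by
      by_contra h
      exact hq (support_fderiv_subset ℝ h)
    simp [hD, this]
  have hψ0 : ∀ q, q ∉ tsupport ψ → ψ q = 0 := fun q hq => image_eq_zero_of_notMem_tsupport hq
  obtain ⟨E1, hE1⟩ := hψc.exists_bound_of_continuous hψ.continuous
  obtain ⟨E2, hE2⟩ := hDs.exists_bound_of_continuous hDc
  simp only [hderiv]
  set ν := volume.restrict U with hν
  set μ := volume.restrict I with hμ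
  have : IsFiniteMeasure ν := isFiniteMeasure_restrict.mpr hUfin
  have : IsFiniteMeasure μ := isFiniteMeasure_restrict.mpr hIfin
  have hprod : μ.prod ν = (volume.prod volume).restrict (I ×ˢ U) := Measure.prod_restrict _ _
  have hIU : MeasurableSet (I ×ˢ U) := hIm.prod hU.measurableSet
  have gen : ∀ (f : Euc N → ℝ → ℝ) (g : Euc N × ℝ → ℝ) (E : ℝ),
      ContinuousOn (fun q : Euc N × ℝ => f q.1 q.2) (U ×ˢ I) →
      (∀ x ∈ U, ∀ t ∈ I, |f x t| ≤ B) → Continuous g → (∀ q, ‖g q‖ ≤ E) →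
      Integrable (fun z : ℝ × Euc N => f z.2 z.1 * g (z.2, z.1)) (μ.prod ν) := by
    intro f g E hf hfB hg hgE
    refine Integrable.of_bound (C := B * E) ?_ ?_
    · rw [hprod]
      refine ContinuousOn.aestronglyMeasurable ?_ hIU
      refine ContinuousOn.mul ?_ (hg.comp continuous_swap).continuousOn
      exact hf.comp continuous_swap.continuousOn (fun z hz => ⟨hz.2, hz.1⟩)
    · rw [hprod]
      filter_upwards [ae_restrict_mem hIU] with z hz
      rw [norm_mul, Real.norm_eq_abs]
      have h1 := hfB z.2 hz.2 z.1 hz.1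
      exact mul_le_mul h1 (hgE _) (norm_nonneg _) ((abs_nonneg _).trans h1)
  have ia := gen φ D E2 hφc hB hDc hE2
  have ib := gen φt ψ E1 hφtc hBt hψ.continuous hE1
  refine ⟨ib.integral_prod_left, ?_⟩
  have e1 := integral_prod _ ia
  have e2 := integral_prod _ ib
  simp only at e1 e2
  rw [← e1, ← e2, eq_neg_iff_add_eq_zero, ← integral_add ia ib]
  refine (integral_prod_symm _ (ia.add ib)).trans ?_
  refine integral_eq_zero_of_ae ?_
  filter_upwards [ae_restrict_mem hU.measurableSet] with x hx
  simp only [Pi.zero_apply]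
  set G : ℝ → ℝ := fun t => φ x t * ψ (x, t) with hG
  set G' : ℝ → ℝ := fun t => φ x t * D (x, t) + φt x t * ψ (x, t) with hG'
  have hGd : ∀ t, HasDerivAt G (G' t) t := by
    intro t
    by_cases ht : (x, t) ∈ tsupport ψ
    · have htI := (hψs ht).2
      have h1 := (hφd x hx t (interior_subset htI)).hasDerivAt (mem_interior_iff_mem_nhds.mp htI)
      have := h1.mul (hdψ x t)
      refine this.congr_deriv ?_
      simp only [hG']; ring
    · have hopen : ∀ᶠ σ in 𝓝 t, (x, σ) ∉ tsupport ψ := by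
        have hc : Continuous (fun σ : ℝ => (x, σ)) := by fun_prop
        exact hc.continuousAt.eventually ((isClosed_tsupport ψ).isOpen_compl.mem_nhds ht)
      have h0 : G' t = 0 := by simp [hG', hD0 _ ht, hψ0 _ ht]
      rw [h0]
      refine (hasDerivAt_const t (0:ℝ)).congr_of_eventuallyEq ?_
      filter_upwards [hopen] with σ hσ
      simp [hG, hψ0 _ hσ]
  have hG0 : ∀ t, t ∉ I → G t = 0 := fun t ht => by
    have : (x, t) ∉ tsupport ψ := fun h => ht (interior_subset (hψs h).2)
    simp [hG, hψ0 _ this]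
  have hG'0 : ∀ t, t ∉ I → G' t = 0 := fun t ht => by
    have : (x, t) ∉ tsupport ψ := fun h => ht (interior_subset (hψs h).2)
    simp [hG', hψ0 _ this, hD0 _ this]
  have hsl : ContinuousOn (fun t : ℝ => (x, t)) I := by fun_prop
  have hsm : MapsTo (fun t : ℝ => (x, t)) I (U ×ˢ I) := fun t ht => ⟨hx, ht⟩
  have c1 : ContinuousOn (fun t => φ x t) I := hφc.comp hsl hsm
  have c2 : ContinuousOn (fun t => φt x t) I := hφtc.comp hsl hsm
  have c3 : Continuous (fun t => ψ (x, t)) := hψ.continuous.comp (by fun_prop)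
  have c4 : Continuous (fun t => D (x, t)) := hDc.comp (by fun_prop)
  have iφψ : ∀ (f : ℝ → ℝ) (g : ℝ → ℝ) (E : ℝ), ContinuousOn f I → (∀ t ∈ I, |f t| ≤ B) →
      Continuous g → (∀ t, ‖g t‖ ≤ E) → Integrable (fun t => f t * g t) μ := by
    intro f g E hf hfB hg hgE
    refine Integrable.of_bound (C := B * E) ((hf.mul hg.continuousOn).aestronglyMeasurable hIm) ?_
    filter_upwards [ae_restrict_mem hIm] with t ht
    rw [norm_mul, Real.norm_eq_abs]
    exact mul_le_mul (hfB t ht) (hgE _) (norm_nonneg _) ((abs_nonneg _).trans (hfB t ht))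
  have iG : Integrable G := by
    have h : IntegrableOn G I := iφψ _ _ E1 c1 (hB x hx) c3 (fun t => hE1 _)
    exact (integrableOn_iff_integrable_of_support_subset (fun t ht => by
      by_contra h; exact ht (hG0 t h))).mp h
  have iG' : Integrable G' := by
    have h : IntegrableOn G' I := (iφψ _ _ E2 c1 (hB x hx) c4 (fun t => hE2 _)).add
      (iφψ _ _ E1 c2 (hBt x hx) c3 (fun t => hE1 _))
    exact (integrableOn_iff_integrable_of_support_subset (fun t ht => by
      by_contra h; exact ht (hG'0 t h))).mp h
  have := integral_eq_zero_of_hasDerivAt_of_integrable hGd iG' iG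
  rw [← setIntegral_eq_integral_of_forall_compl_eq_zero hG'0] at this
  exact this

lemma taylor_bounds {N : ℕ} {ρ B : ℝ} {w : Euc N → ℝ}
    {Dw : Euc N → (Euc N →L[ℝ] ℝ)} {D2w : Euc N → (Euc N →L[ℝ] Euc N →L[ℝ] ℝ)} {x : Euc N}
    (h1 : ∀ y ∈ ball x ρ, HasFDerivAt w (Dw y) y)
    (h2 : ∀ y ∈ ball x ρ, HasFDerivAt Dw (D2w y) y)
    (hB1 : ∀ y ∈ ball x ρ, ‖Dw y‖ ≤ B) (hB2 : ∀ y ∈ ball x ρ, ‖D2w y‖ ≤ B)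
    (h : Euc N) (hh : ‖h‖ < ρ) :
    |w x - w (x + h)| ≤ B * ‖h‖ ∧ |w x - w (x + h) - (-(Dw x h))| ≤ B * ‖h‖ ^ 2 := by
  have hx : x ∈ ball x ρ := mem_ball_self ((norm_nonneg h).trans_lt hh)
  have hxh : x + h ∈ ball x ρ := by simpa using hh
  have hB0 : 0 ≤ B := (norm_nonneg _).trans (hB1 x hx)
  constructor
  · have := (convex_ball x ρ).norm_image_sub_le_of_norm_hasFDerivWithin_le
      (fun y hy => (h1 y hy).hasFDerivWithinAt) hB1 hxh hx
    simpa [Real.norm_eq_abs] using this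
  · have hsub : closedBall x ‖h‖ ⊆ ball x ρ := closedBall_subset_ball hh
    have hD : ∀ y ∈ closedBall x ‖h‖, ‖Dw y - Dw x‖ ≤ B * ‖h‖ := by
      intro y hy
      have := (convex_ball x ρ).norm_image_sub_le_of_norm_hasFDerivWithin_le
        (fun y hy => (h2 y hy).hasFDerivWithinAt) hB2 hx (hsub hy)
      refine this.trans ?_
      have : ‖y - x‖ ≤ ‖h‖ := by rw [← dist_eq_norm]; exact hy
      gcongr
    have := (convex_closedBall x ‖h‖).norm_image_sub_le_of_norm_hasFDerivWithin_le'
      (f := w) (φ := Dw x) (C := B * ‖h‖) (x := x) (y := x + h)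
      (fun y hy => (h1 y (hsub hy)).hasFDerivWithinAt) hD (mem_closedBall_self (norm_nonneg _))
      (by simp)
    rw [add_sub_cancel_left, Real.norm_eq_abs] at this
    rw [← abs_neg]
    calc _ = |w (x + h) - w x - (Dw x) h| := by congr 1; ring
      _ ≤ _ := this
      _ = _ := by ring

/-- a pointwise supersolution of the truncated equation is a weak
supersolution. -/
theorem pointwise_supersolution_is_weak_supersolution
    (N : ℕ) (hN : 1 ≤ N) (p s Lam : ℝ)
    (hp : 1 < p) (hs : s ∈ Ioo (0 : ℝ) 1) (hLam : 0 < Lam)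
    (K : Euc N → ℝ)
    (hKm : Measurable K) (hKpos : ∀ z : Euc N, z ≠ 0 → 0 < K z)
    (hKsymm : ∀ z : Euc N, z ≠ 0 → K (-z) = K z)
    (hKub : ∀ z : Euc N, z ≠ 0 → K z ≤ Lam * ‖z‖ ^ (-((N : ℝ) + s * p)))
    (Ω U V 𝒦 : Set (Euc N)) (I : Set ℝ)
    (hΩ : IsOpen Ω) (hV : IsOpen V) (h𝒦 : IsCompact 𝒦) (hV𝒦 : V ⊆ 𝒦)
    (hI : Bornology.IsBounded I) (hIc : I.OrdConnected)
    (hU : IsOpen U) (h𝒦U : 𝒦 ⊆ U) (hUc : IsCompact (closure U)) (hUΩ : closure U ⊆ Ω)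
    (ρ : ℝ) (hρ : 0 < ρ) (hρU : ∀ x ∈ 𝒦, ball x ρ ⊆ U)
    (φ : Euc N → ℝ → ℝ) (Dφ : Euc N → ℝ → (Euc N →L[ℝ] ℝ))
    (D2φ : Euc N → ℝ → (Euc N →L[ℝ] Euc N →L[ℝ] ℝ)) (φt : Euc N → ℝ → ℝ)
    (hreg : C2xC1t N U I φ Dφ D2φ φt)
    (hbd : ∃ B : ℝ, ∀ x ∈ U, ∀ t ∈ I,
      |φ x t| ≤ B ∧ ‖Dφ x t‖ ≤ B ∧ ‖D2φ x t‖ ≤ B ∧ |φt x t| ≤ B)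
    (m : ℝ) (hm : 0 < m) (hgrad : ∀ x ∈ U, ∀ t ∈ I, m ≤ ‖Dφ x t‖)
    (hsuper : ∀ x ∈ V, ∀ t ∈ I, ∃ l : ℝ,
      HasPV N p ρ K (fun y => φ y t) x l ∧ 0 ≤ φt x t + l) :
    ∀ ψ : Euc N × ℝ → ℝ, ContDiff ℝ (⊤ : ℕ∞) ψ → HasCompactSupport ψ →
      tsupport ψ ⊆ V ×ˢ interior I → (∀ q, 0 ≤ ψ q) →
      0 ≤ -(∫ t in I, ∫ x in U, φ x t * deriv (fun σ => ψ (x, σ)) t) +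
        (1 / 2) * ∫ t in I,
          ∫ q in {q : Euc N × Euc N | q.1 ∈ U ∧ q.2 ∈ U ∧ dist q.1 q.2 < ρ},
            Jp p (φ q.1 t - φ q.2 t) * (ψ (q.1, t) - ψ (q.2, t)) * K (q.1 - q.2) := by
  intro ψ hψ hψc hψs hψ0
  obtain ⟨hφc, hφ1, hDc, hφ2, hD2c, hφd, hφtc⟩ := hreg
  obtain ⟨B0, hB0⟩ := hbd
  set B := |B0| + 1 with hB
  have hBpos : 0 < B := by positivity
  have hBle : B0 ≤ B := (le_abs_self B0).trans (by linarith)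
  have hVU : V ⊆ U := hV𝒦.trans h𝒦U
  have hUfin : volume U ≠ ⊤ :=
    ((measure_mono subset_closure).trans_lt hUc.measure_lt_top).ne
  have hIm : MeasurableSet I := hIc.measurableSet
  have hIfin : volume I ≠ ⊤ := hI.measure_lt_top.ne
  have hρV : ∀ x ∈ V, ball x ρ ⊆ U := fun x hx => hρU x (hV𝒦 hx)
  have hT : ∀ t ∈ I, ∀ x ∈ V, ∀ h : Euc N, ‖h‖ < ρ →
      |φ x t - φ (x + h) t| ≤ B * ‖h‖ ∧
        |φ x t - φ (x + h) t - (-(Dφ x t h))| ≤ B * ‖h‖ ^ 2 := by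
    intro t ht x hx h hh
    exact taylor_bounds (w := fun y => φ y t) (Dw := fun y => Dφ y t) (D2w := fun y => D2φ y t)
      (fun y hy => hφ1 y (hρV x hx hy) t ht) (fun y hy => hφ2 y (hρV x hx hy) t ht)
      (fun y hy => (hB0 y (hρV x hx hy) t ht).2.1.trans hBle)
      (fun y hy => (hB0 y (hρV x hx hy) t ht).2.2.1.trans hBle) h hh
  have hwL : ∀ t ∈ I, ∀ x ∈ V, ∀ y, dist x y < ρ → |φ x t - φ y t| ≤ B * dist x y := by
    intro t ht x hx y hd
    have := (hT t ht x hx (y - x) (by rwa [← dist_eq_norm, dist_comm])).1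
    rwa [add_sub_cancel, ← dist_eq_norm, dist_comm y x] at this
  have hwc : ∀ t ∈ I, ContinuousOn (fun x => φ x t) U := fun t ht =>
    hφc.comp (f := fun x => (x, t)) (by fun_prop) (fun x hx => ⟨hx, ht⟩)
  obtain ⟨M, hM⟩ := exists_pv_bound hN hp hs hLam hKm hKpos hKsymm hKub hρ hm hBpos
  obtain ⟨L, hL⟩ := hψ.lipschitzWith_of_hasCompactSupport hψc (by simp)
  obtain ⟨E, hE⟩ := hψc.exists_bound_of_continuous hψ.continuous
  have hηL : ∀ t, ∀ x y : Euc N, |ψ (x, t) - ψ (y, t)| ≤ L * dist x y := by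
    intro t x y
    have := hL.dist_le_mul (x, t) (y, t)
    rwa [Real.dist_eq, Prod.dist_eq, dist_self, max_eq_left dist_nonneg] at this
  have hψV : ∀ t, ∀ x, x ∉ V → ψ (x, t) = 0 := fun t x hx =>
    image_eq_zero_of_notMem_tsupport fun h => hx (hψs h).1
  obtain ⟨hti, hparts⟩ := time_parts hI hIc hU hUfin hφc hφd hφtc
    (fun x hx t ht => (hB0 x hx t ht).1.trans hBle)
    (fun x hx t ht => (hB0 x hx t ht).2.2.2.trans hBle) hψ hψc hψs
  rw [hparts, neg_neg]
  set S := {q : Euc N × Euc N | q.1 ∈ U ∧ q.2 ∈ U ∧ dist q.1 q.2 < ρ} with hS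
  have hSm : MeasurableSet S := measurableSet_S hU ρ
  set F : ℝ → ℝ := fun t => ∫ q in S,
    Jp p (φ q.1 t - φ q.2 t) * (ψ (q.1, t) - ψ (q.2, t)) * K (q.1 - q.2) with hF
  have : IsFiniteMeasure (volume.restrict U) := isFiniteMeasure_restrict.mpr hUfin
  have : IsFiniteMeasure (volume.restrict I) := isFiniteMeasure_restrict.mpr hIfin
  -- pointwise in time inequality
  have hpt : ∀ t ∈ I, 0 ≤ (∫ x in U, φt x t * ψ (x, t)) + (1 / 2) * F t := by
    intro t ht
    have hηc : Continuous (fun x : Euc N => ψ (x, t)) := hψ.continuous.comp (by fun_prop)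
    have hηs : ∀ x, x ∉ U → ψ (x, t) = 0 := fun x hx => hψV t x fun h => hx (hVU h)
    have hηi : Integrable (fun x : Euc N => ψ (x, t)) := by
      have h : IntegrableOn (fun x : Euc N => ψ (x, t)) U :=
        Integrable.of_bound (C := E) hηc.aestronglyMeasurable (Eventually.of_forall fun x => hE _)
      exact (integrableOn_iff_integrable_of_support_subset (fun x hx => by
        by_contra h; exact hx (hηs x h))).mp h
    have hθ : IntegrableOn (fun x => φt x t * ψ (x, t)) U := by
      have hc : ContinuousOn (fun x => φt x t) U :=
        hφtc.comp (f := fun x => (x, t)) (by fun_prop) (fun x hx => ⟨hx, ht⟩)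
      refine Integrable.of_bound (C := B * E)
        ((hc.mul hηc.continuousOn).aestronglyMeasurable hU.measurableSet) ?_
      filter_upwards [ae_restrict_mem hU.measurableSet] with x hx
      rw [norm_mul, Real.norm_eq_abs]
      exact mul_le_mul ((hB0 x hx t ht).2.2.2.trans hBle) (hE _) (norm_nonneg _) hBpos.le
    exact spatial_ineq hN hp hs hLam hKm hKpos hKsymm hKub hU hUfin hVU hρ hBpos L.2 hρV
      (w := fun x => φ x t) (η := fun x => ψ (x, t)) (θ := fun x => φt x t)
      (hwc t ht) (fun x hx => (hB0 x hx t ht).1.trans hBle) (hwL t ht) hηc hηi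
      (fun x => hE (x, t)) (fun x => hψ0 _) (hψV t) (hηL t) hθ
      (fun x hx δ hδ => hM (fun x => φ x t) x (Dφ x t) ((hwc t ht).mono (hρV x hx))
        (hgrad x (hVU hx) t ht) ((hB0 x (hVU hx) t ht).2.1.trans hBle)
        (fun h hh => (hT t ht x hx h hh).1) (fun h hh => (hT t ht x hx h hh).2) δ hδ)
      (fun x hx => hsuper x hx t ht)
  -- integrability in time
  have hg := (integrableOn_S_norm_rpow hN hU hUfin (γ := p - (N + s * p)) (ρ := ρ)
    (by nlinarith [hs.1, hs.2]) hρ).const_mul (B ^ (p - 1) * L * Lam)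
  have hFi : Integrable F (volume.restrict I) := by
    have hmeas : AEStronglyMeasurable (fun z : ℝ × (Euc N × Euc N) =>
        Jp p (φ z.2.1 z.1 - φ z.2.2 z.1) * (ψ (z.2.1, z.1) - ψ (z.2.2, z.1)) * K (z.2.1 - z.2.2))
        ((volume.restrict I).prod (volume.restrict S)) := by
      have hψm := hψ.continuous.measurable
      have hIS : MeasurableSet (I ×ˢ S) := hIm.prod hSm
      rw [Measure.prod_restrict]
      have hJ : AEMeasurable (fun z : ℝ × (Euc N × Euc N) => Jp p (φ z.2.1 z.1 - φ z.2.2 z.1))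
          ((volume.prod volume).restrict (I ×ˢ S)) := by
        refine (measurable_Jp p).comp_aemeasurable (ContinuousOn.aemeasurable ?_ hIS)
        refine ContinuousOn.sub
          (hφc.comp (f := fun z : ℝ × (Euc N × Euc N) => (z.2.1, z.1)) (by fun_prop) ?_)
          (hφc.comp (f := fun z : ℝ × (Euc N × Euc N) => (z.2.2, z.1)) (by fun_prop) ?_)
        · intro z hz; exact ⟨hz.2.1, hz.1⟩
        · intro z hz; exact ⟨hz.2.2.1, hz.1⟩
      have h2 : Measurable (fun z : ℝ × (Euc N × Euc N) => ψ (z.2.1, z.1) - ψ (z.2.2, z.1)) := by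
        fun_prop
      have h3 : Measurable (fun z : ℝ × (Euc N × Euc N) => K (z.2.1 - z.2.2)) := by
        fun_prop
      exact ((hJ.mul h2.aemeasurable).mul h3.aemeasurable).aestronglyMeasurable
    refine Integrable.of_bound (C := ∫ q in S, (B ^ (p - 1) * L * Lam) *
      ‖q.1 - q.2‖ ^ (p - (N + s * p))) hmeas.integral_prod_right' ?_
    filter_upwards [ae_restrict_mem hIm] with t ht
    refine norm_integral_le_of_norm_le hg ?_
    filter_upwards [ae_restrict_mem hSm] with q hq
    exact integrand_bound hp hLam hKpos hKub hBpos L.2 (w := fun x => φ x t)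
      (η := fun x => ψ (x, t)) (hwL t ht) (hψV t) (hηL t) q.1 q.2 hq.2.2
  rw [← integral_const_mul, ← integral_add hti (hFi.const_mul _)]
  exact setIntegral_nonneg hIm hpt
end
end

section
/- Let p ≥ 2, let K be a kernel with constants λ, Λ, let R > 0, and let u be a local weak solution of ∂_t u + L_K u = 0 in B_{2R} × (-2R^{sp}, 0]. Assume M := ess sup_{B_{2R} × (-2R^{sp},0]} |u| + Tail_∞(u; 0, R, (-2R^{sp}, 0]) + 1 is finite, and let τ ∈ [-R^{sp}(1 - M^{2-p}), 0]. Define v(x,t) := M^{-1} u(Rx, M^{2-p} R^{sp} t + τ) and K'(z) := R^{N+sp} K(Rz). Then K' is a kernel with the same constants λ, Λ, v is a local weak solution of ∂_t v + L_{K'} v = 0 in B_2 × (-2, 0], and ess sup_{B_2 × (-2,0]} |v| + Tail_∞(v; 0, 1, (-1, 0]) ≤ 1. -/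
open MeasureTheory Set Metric Filter
open scoped ENNReal NNReal Topology Classical

noncomputable section

section ChangeOfVariables

variable {X : Type*} [TopologicalSpace X] [MeasurableSpace X] [BorelSpace X] {μ : Measure X}

lemma map_restrict_homeo (e : X ≃ₜ X) {c : ℝ≥0∞} (h : Measure.map e μ = c • μ) (U : Set X) :
    Measure.map e (μ.restrict U) = c • μ.restrict (e '' U) := by
  have := e.measurableEmbedding.restrict_map μ (e '' U)
  rw [e.injective.preimage_image] at this
  rw [← this, h, Measure.restrict_smul]

lemma lintegral_homeo (e : X ≃ₜ X) {c : ℝ≥0∞} (h : Measure.map e μ = c • μ) (U : Set X)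
    (f : X → ℝ≥0∞) : ∫⁻ x in U, f (e x) ∂μ = c * ∫⁻ x in e '' U, f x ∂μ := by
  rw [← e.measurableEmbedding.lintegral_map, map_restrict_homeo e h, lintegral_smul_measure,
    smul_eq_mul]

lemma integral_homeo (e : X ≃ₜ X) {c : ℝ≥0∞} (h : Measure.map e μ = c • μ) (U : Set X)
    (f : X → ℝ) : ∫ x in U, f (e x) ∂μ = c.toReal * ∫ x in e '' U, f x ∂μ := by
  rw [← e.measurableEmbedding.integral_map, map_restrict_homeo e h, integral_smul_measure,
    smul_eq_mul]

lemma integral_homeo_univ (e : X ≃ₜ X) {c : ℝ≥0∞} (h : Measure.map e μ = c • μ)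
    (f : X → ℝ) : ∫ x, f (e x) ∂μ = c.toReal * ∫ x, f x ∂μ := by
  rw [← e.measurableEmbedding.integral_map, h, integral_smul_measure,
    smul_eq_mul]

lemma lintegral_homeo_univ (e : X ≃ₜ X) {c : ℝ≥0∞} (h : Measure.map e μ = c • μ)
    (f : X → ℝ≥0∞) : ∫⁻ x, f (e x) ∂μ = c * ∫⁻ x, f x ∂μ := by
  rw [← e.measurableEmbedding.lintegral_map, h, lintegral_smul_measure,
    smul_eq_mul]

lemma ae_homeo (e : X ≃ₜ X) {c : ℝ≥0∞} (h : Measure.map e μ = c • μ) {U V : Set X}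
    (hUV : e '' U ⊆ V) {P : X → Prop} (hP : ∀ᵐ y ∂μ.restrict V, P y) :
    ∀ᵐ x ∂μ.restrict U, P (e x) := by
  rw [← e.measurableEmbedding.ae_map_iff, map_restrict_homeo e h]
  exact Measure.ae_smul_measure (ae_restrict_of_ae_restrict_of_subset hUV hP) c

lemma essSup_homeo_le (e : X ≃ₜ X) {c : ℝ≥0∞} (h : Measure.map e μ = c • μ) {U V : Set X}
    (hUV : e '' U ⊆ V) {f g : X → ℝ≥0∞} {C : ℝ≥0∞} (hfg : ∀ x, f x ≤ C * g (e x)) :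
    essSup f (μ.restrict U) ≤ C * essSup g (μ.restrict V) := by
  refine essSup_le_of_ae_le _ ?_
  have h1 : ∀ᵐ y ∂μ.restrict V, g y ≤ essSup g (μ.restrict V) := ENNReal.ae_le_essSup g
  filter_upwards [ae_homeo e h hUV h1] with x hx
  exact (hfg x).trans (by gcongr)

end ChangeOfVariables

/-- Spatial dilation. -/
def eSp (N : ℕ) (R : ℝ) (hR : R ≠ 0) : Euc N ≃ₜ Euc N := Homeomorph.smulOfNeZero R hR

/-- Affine time change. -/
def eTm (θ τ : ℝ) (hθ : θ ≠ 0) : ℝ ≃ₜ ℝ := (Homeomorph.mulLeft₀ θ hθ).trans (Homeomorph.addRight τ)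

@[simp] lemma eSp_apply (N : ℕ) (R : ℝ) (hR : R ≠ 0) (x : Euc N) : eSp N R hR x = R • x := rfl

@[simp] lemma eTm_apply (θ τ : ℝ) (hθ : θ ≠ 0) (t : ℝ) : eTm θ τ hθ t = θ * t + τ := rfl

lemma map_eSp (N : ℕ) (R : ℝ) (hR : 0 < R) :
    Measure.map (eSp N R hR.ne') volume = ENNReal.ofReal ((R ^ N)⁻¹) • (volume : Measure (Euc N)) := by
  have := Measure.map_addHaar_smul (volume : Measure (Euc N)) hR.ne'
  have h2 : (⇑(eSp N R hR.ne') : Euc N → Euc N) = (R • ·) := rfl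
  rw [h2, this]
  simp [abs_of_pos hR]

lemma map_eTm (θ τ : ℝ) (hθ : 0 < θ) :
    Measure.map (eTm θ τ hθ.ne') volume = ENNReal.ofReal (θ⁻¹) • (volume : Measure ℝ) := by
  have h2 : (⇑(eTm θ τ hθ.ne') : ℝ → ℝ) = (· + τ) ∘ (θ * ·) := rfl
  rw [h2, ← Measure.map_map (by fun_prop) (by fun_prop), Real.map_volume_mul_left hθ.ne',
    Measure.map_smul, map_add_right_eq_self, abs_of_pos (inv_pos.2 hθ)]

lemma norm_rpow_scale {N : ℕ} {R : ℝ} (hR : 0 < R) (a : ℝ) (z : Euc N) :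
    ‖z‖ ^ (-a) = R ^ a * ‖R • z‖ ^ (-a) := by
  rw [norm_smul, Real.norm_of_nonneg hR.le, Real.mul_rpow hR.le (norm_nonneg _), ← mul_assoc,
    ← Real.rpow_add hR]
  simp

lemma isKernel_scale {N : ℕ} {p s lam Lam R : ℝ} (hR : 0 < R) {K : Euc N → ℝ}
    (hK : IsKernel N p s lam Lam K) :
    IsKernel N p s lam Lam (fun z => R ^ ((N : ℝ) + s * p) * K (R • z)) := by
  obtain ⟨h1, h2, h3, h4⟩ := hK
  have hz : ∀ z : Euc N, z ≠ 0 → R • z ≠ 0 := fun z hz => smul_ne_zero hR.ne' hz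
  have hRa : 0 < R ^ ((N : ℝ) + s * p) := Real.rpow_pos_of_pos hR _
  refine ⟨?_, fun z h => mul_pos hRa (h2 _ (hz z h)), fun z h => ?_, fun z h => ?_⟩
  · exact (h1.comp (measurable_const_smul R)).const_mul _
  · simp only [smul_neg, h3 _ (hz z h)]
  · obtain ⟨ha, hb⟩ := h4 _ (hz z h)
    rw [norm_rpow_scale hR]
    constructor
    · calc _ = R ^ ((N : ℝ) + s * p) * (lam * ‖R • z‖ ^ (-((N : ℝ) + s * p))) := by ring
        _ ≤ _ := mul_le_mul_of_nonneg_left ha hRa.le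
    · calc R ^ ((N : ℝ) + s * p) * K (R • z)
          ≤ R ^ ((N : ℝ) + s * p) * (Lam * ‖R • z‖ ^ (-((N : ℝ) + s * p))) := by gcongr
        _ = _ := by ring

lemma tailFn_scale {N : ℕ} {p s R M : ℝ} (hp : 2 ≤ p) (hR : 0 < R) (hM : 0 < M) (w : Euc N → ℝ) :
    tailFn N p s (fun x => M⁻¹ * w (R • x)) 0 1 = M⁻¹ * tailFn N p s w 0 R := by
  have himg : eSp N R hR.ne' '' (ball (0 : Euc N) 1)ᶜ = (ball (0 : Euc N) R)ᶜ := by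
    ext y
    simp only [Set.mem_image, mem_compl_iff, mem_ball_zero_iff, eSp_apply, not_lt]
    constructor
    · rintro ⟨x, hx, rfl⟩
      rw [norm_smul, Real.norm_of_nonneg hR.le]
      nlinarith
    · intro h
      refine ⟨R⁻¹ • y, ?_, by simp [smul_smul, hR.ne']⟩
      rw [norm_smul, norm_inv, Real.norm_of_nonneg hR.le, inv_mul_eq_div, le_div_iff₀ hR]
      linarith
  have hint : ∀ x : Euc N, |M⁻¹ * w (R • x)| ^ (p - 1) * ‖x - 0‖ ^ (-((N : ℝ) + s * p)) =
      (M⁻¹ ^ (p - 1) * R ^ ((N : ℝ) + s * p)) * (|w (eSp N R hR.ne' x)| ^ (p - 1) *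
        ‖eSp N R hR.ne' x - 0‖ ^ (-((N : ℝ) + s * p))) := by
    intro x
    rw [abs_mul, abs_of_pos (inv_pos.2 hM), Real.mul_rpow (inv_pos.2 hM).le (abs_nonneg _), sub_zero,
      sub_zero, norm_rpow_scale hR, eSp_apply]
    ring
  have hp1 : p - 1 ≠ 0 := by linarith
  unfold tailFn
  simp_rw [hint]
  rw [integral_const_mul, integral_homeo (eSp N R hR.ne') (map_eSp N R hR) _
    (fun y => |w y| ^ (p - 1) * ‖y - 0‖ ^ (-((N : ℝ) + s * p))), himg]
  rw [ENNReal.toReal_ofReal (by positivity), Real.one_rpow, one_mul]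
  set A := ∫ x in (ball (0 : Euc N) R)ᶜ, |w x| ^ (p - 1) * ‖x - 0‖ ^ (-((N : ℝ) + s * p)) with hA
  have hA0 : 0 ≤ A := integral_nonneg (fun x => by positivity)
  have : M⁻¹ ^ (p - 1) * R ^ ((N : ℝ) + s * p) * ((R ^ N)⁻¹ * A) =
      M⁻¹ ^ (p - 1) * (R ^ (s * p) * A) := by
    rw [Real.rpow_add hR, Real.rpow_natCast]
    field_simp
  rw [this, Real.mul_rpow (by positivity) (by positivity), ← Real.rpow_mul (by positivity),
    mul_one_div_cancel hp1, Real.rpow_one]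


lemma Jp_scale {p M : ℝ} (hM : 0 < M) (d : ℝ) : Jp p (M⁻¹ * d) = M⁻¹ ^ (p - 1) * Jp p d := by
  have hM' := inv_pos.2 hM
  unfold Jp
  rw [abs_mul, abs_of_pos hM', Real.mul_rpow hM'.le (abs_nonneg _),
    show p - 1 = (p - 2) + 1 by ring, Real.rpow_add_one hM'.ne']
  ring

lemma image_eSp_ball (N : ℕ) {R : ℝ} (hR : 0 < R) :
    eSp N R hR.ne' '' ball (0 : Euc N) 2 = ball (0 : Euc N) (2 * R) := by
  ext y
  simp only [Set.mem_image, mem_ball_zero_iff, eSp_apply]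
  constructor
  · rintro ⟨x, hx, rfl⟩
    rw [norm_smul, Real.norm_of_nonneg hR.le]
    nlinarith
  · intro h
    refine ⟨R⁻¹ • y, ?_, by simp [smul_smul, hR.ne']⟩
    rw [norm_smul, norm_inv, Real.norm_of_nonneg hR.le, inv_mul_eq_div, div_lt_iff₀ hR]
    linarith

/-- Scaling of the local energy and integrability conditions. -/
lemma local_scale {N : ℕ} {p s R M θ τ T : ℝ} (hR : 0 < R)
    (hM : 0 < M) (hθ : 0 < θ) (hτ : τ ≤ 0) (hT : T ≤ -2 * θ + τ) (u : Euc N → ℝ → ℝ)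
    (hu : ∀ J : Set ℝ, IsCompact J → J ⊆ interior (Ioc T 0) →
    ∀ U : Set (Euc N), IsOpen U → IsCompact (closure U) → closure U ⊆ ball 0 (2 * R) →
      (∫⁻ t in J, ∫⁻ x in U, ∫⁻ y in U,
          ENNReal.ofReal (|u x t - u y t| ^ p * ‖x - y‖ ^ (-((N : ℝ) + s * p)))) < ⊤ ∧
      (∫⁻ t in J, ∫⁻ x in U, ENNReal.ofReal (|u x t| ^ p)) < ⊤ ∧
      essSup (fun t => ∫⁻ x, ENNReal.ofReal (|u x t| ^ (p - 1) / (1 + ‖x‖ ^ ((N : ℝ) + s * p))))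
        (volume.restrict J) < ⊤ ∧
      (∀ t₀ ∈ Ioc T 0, Tendsto (fun t => ∫ x in U, (u x t - u x t₀) ^ 2)
          (nhdsWithin t₀ (Ioc T 0)) (nhds 0)))
    (v : Euc N → ℝ → ℝ) (hv : v = fun x t => M⁻¹ * u (R • x) (θ * t + τ)) :
    ∀ J : Set ℝ, IsCompact J → J ⊆ interior (Ioc (-2) 0) →
    ∀ U : Set (Euc N), IsOpen U → IsCompact (closure U) → closure U ⊆ ball 0 2 →
      (∫⁻ t in J, ∫⁻ x in U, ∫⁻ y in U,
          ENNReal.ofReal (|v x t - v y t| ^ p * ‖x - y‖ ^ (-((N : ℝ) + s * p)))) < ⊤ ∧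
      (∫⁻ t in J, ∫⁻ x in U, ENNReal.ofReal (|v x t| ^ p)) < ⊤ ∧
      essSup (fun t => ∫⁻ x, ENNReal.ofReal (|v x t| ^ (p - 1) / (1 + ‖x‖ ^ ((N : ℝ) + s * p))))
        (volume.restrict J) < ⊤ ∧
      (∀ t₀ ∈ Ioc (-2 : ℝ) 0, Tendsto (fun t => ∫ x in U, (v x t - v x t₀) ^ 2)
          (nhdsWithin t₀ (Ioc (-2) 0)) (nhds 0)) := by
  subst hv
  intro J hJ hJI U hUo hUc hUΩ
  have hM' := inv_pos.2 hM
  set e := eSp N R hR.ne' with he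
  set f := eTm θ τ hθ.ne' with hf
  have hme : Measure.map e volume = ENNReal.ofReal ((R ^ N)⁻¹) • (volume : Measure (Euc N)) :=
    map_eSp N R hR
  have hmf : Measure.map f volume = ENNReal.ofReal (θ⁻¹) • (volume : Measure ℝ) :=
    map_eTm θ τ hθ
  have hJ' : f '' J ⊆ interior (Ioc T 0) := by
    rw [interior_Ioc] at *
    rintro _ ⟨t, ht, rfl⟩
    obtain ⟨h1, h2⟩ := hJI ht
    rw [hf, eTm_apply]
    constructor <;> nlinarith
  have hcl : closure (e '' U) = e '' closure U := (e.image_closure U).symm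
  obtain ⟨h1, h2, h3, h4⟩ := hu (f '' J) (hJ.image f.continuous) hJ' (e '' U)
    (e.isOpenMap U hUo) (by rw [hcl]; exact hUc.image e.continuous)
    (by rw [hcl, ← image_eSp_ball N hR]; exact image_mono hUΩ)
  have ht : ∀ t, θ * t + τ = f t := fun t => rfl
  have hx : ∀ x : Euc N, R • x = e x := fun x => rfl
  refine ⟨?_, ?_, ?_, ?_⟩
  · have hint : ∀ (t : ℝ) (x y : Euc N),
        ENNReal.ofReal (|M⁻¹ * u (R • x) (θ * t + τ) - M⁻¹ * u (R • y) (θ * t + τ)| ^ p *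
          ‖x - y‖ ^ (-((N : ℝ) + s * p))) =
        ENNReal.ofReal (M⁻¹ ^ p * R ^ ((N : ℝ) + s * p)) *
        ENNReal.ofReal (|u (e x) (f t) - u (e y) (f t)| ^ p *
          ‖e x - e y‖ ^ (-((N : ℝ) + s * p))) := by
      intro t x y
      rw [← ENNReal.ofReal_mul (by positivity), ← mul_sub, abs_mul, abs_of_pos hM',
        Real.mul_rpow hM'.le (abs_nonneg _), norm_rpow_scale hR, smul_sub, ht, hx, hx]
      congr 1
      ring
    simp_rw [hint]
    have hy : ∀ (t : ℝ) (x : Euc N), ∫⁻ y in U, 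
        ENNReal.ofReal (M⁻¹ ^ p * R ^ ((N : ℝ) + s * p)) *
        ENNReal.ofReal (|u (e x) (f t) - u (e y) (f t)| ^ p *
          ‖e x - e y‖ ^ (-((N : ℝ) + s * p))) =
        (ENNReal.ofReal (M⁻¹ ^ p * R ^ ((N : ℝ) + s * p)) * ENNReal.ofReal ((R ^ N)⁻¹)) *
          ∫⁻ y in e '' U, ENNReal.ofReal (|u (e x) (f t) - u y (f t)| ^ p *
          ‖e x - y‖ ^ (-((N : ℝ) + s * p))) := by
      intro t x
      rw [lintegral_const_mul' _ _ ENNReal.ofReal_ne_top, lintegral_homeo e hme U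
        (fun y => ENNReal.ofReal (|u (e x) (f t) - u y (f t)| ^ p *
          ‖e x - y‖ ^ (-((N : ℝ) + s * p)))), mul_assoc]
    simp_rw [hy]
    generalize hC : ENNReal.ofReal (M⁻¹ ^ p * R ^ ((N : ℝ) + s * p)) * ENNReal.ofReal ((R ^ N)⁻¹) = C
    have hCt : C ≠ ⊤ := by rw [← hC]; exact ENNReal.mul_ne_top ENNReal.ofReal_ne_top ENNReal.ofReal_ne_top
    simp_rw [lintegral_const_mul' _ _ hCt]
    simp_rw [fun t => lintegral_homeo e hme U
      (fun x => ∫⁻ y in e '' U, ENNReal.ofReal (|u x (f t) - u y (f t)| ^ p *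
          ‖x - y‖ ^ (-((N : ℝ) + s * p))))]
    simp_rw [lintegral_const_mul' _ _ ENNReal.ofReal_ne_top]
    rw [lintegral_homeo f hmf J
      (fun t => ∫⁻ x in e '' U, ∫⁻ y in e '' U, ENNReal.ofReal (|u x t - u y t| ^ p *
          ‖x - y‖ ^ (-((N : ℝ) + s * p))))]
    exact ENNReal.mul_lt_top hCt.lt_top (ENNReal.mul_lt_top ENNReal.ofReal_lt_top
      (ENNReal.mul_lt_top ENNReal.ofReal_lt_top h1))
  · have hint : ∀ (t : ℝ) (x : Euc N), ENNReal.ofReal (|M⁻¹ * u (R • x) (θ * t + τ)| ^ p) =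
        ENNReal.ofReal (M⁻¹ ^ p) * ENNReal.ofReal (|u (e x) (f t)| ^ p) := by
      intro t x
      rw [← ENNReal.ofReal_mul (by positivity), abs_mul, abs_of_pos hM',
        Real.mul_rpow hM'.le (abs_nonneg _)]
      rfl
    simp_rw [hint, lintegral_const_mul' _ _ ENNReal.ofReal_ne_top]
    simp_rw [fun t => lintegral_homeo e hme U (fun x => ENNReal.ofReal (|u x (f t)| ^ p))]
    simp_rw [lintegral_const_mul' _ _ ENNReal.ofReal_ne_top]
    rw [lintegral_homeo f hmf J (fun t => ∫⁻ x in e '' U, ENNReal.ofReal (|u x t| ^ p))]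
    exact ENNReal.mul_lt_top ENNReal.ofReal_lt_top (ENNReal.mul_lt_top ENNReal.ofReal_lt_top
      (ENNReal.mul_lt_top ENNReal.ofReal_lt_top h2))
  · set a := (N : ℝ) + s * p with ha
    set C := ENNReal.ofReal (M⁻¹ ^ (p - 1) * (1 + R ^ a)) * ENNReal.ofReal ((R ^ N)⁻¹) with hC
    have hCt : C < ⊤ := ENNReal.mul_lt_top ENNReal.ofReal_lt_top ENNReal.ofReal_lt_top
    refine lt_of_le_of_lt (essSup_homeo_le f hmf subset_rfl (C := C)
      (g := fun t => ∫⁻ x, ENNReal.ofReal (|u x t| ^ (p - 1) / (1 + ‖x‖ ^ a))) ?_)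
      (ENNReal.mul_lt_top hCt h3)
    intro t
    rw [hC, mul_assoc, ← lintegral_homeo_univ e hme
      (fun x => ENNReal.ofReal (|u x (f t)| ^ (p - 1) / (1 + ‖x‖ ^ a))),
      ← lintegral_const_mul' _ _ ENNReal.ofReal_ne_top]
    refine lintegral_mono fun x => ?_
    rw [← ENNReal.ofReal_mul (by positivity)]
    refine ENNReal.ofReal_le_ofReal ?_
    rw [abs_mul, abs_of_pos hM', Real.mul_rpow hM'.le (abs_nonneg _), ht, hx]
    have hnorm : ‖e x‖ ^ a = R ^ a * ‖x‖ ^ a := by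
      rw [← hx, norm_smul, Real.norm_of_nonneg hR.le, Real.mul_rpow hR.le (norm_nonneg _)]
    rw [hnorm, mul_div_assoc, mul_assoc]
    refine mul_le_mul_of_nonneg_left ?_ (by positivity)
    rw [← mul_div_assoc, div_le_div_iff₀ (by positivity) (by positivity)]
    have hb : 0 ≤ |u (e x) (f t)| ^ (p - 1) := by positivity
    have hr : 0 ≤ R ^ a := by positivity
    have hz : 0 ≤ ‖x‖ ^ a := by positivity
    have : 1 + R ^ a * ‖x‖ ^ a ≤ (1 + R ^ a) * (1 + ‖x‖ ^ a) := by nlinarith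
    nlinarith
  · intro t₀ ht₀
    have hmaps : MapsTo f (Ioc (-2) 0) (Ioc T 0) := by
      rintro t ⟨h1, h2⟩
      rw [hf, eTm_apply]
      constructor <;> nlinarith
    have hlim := (h4 (f t₀) (hmaps ht₀)).comp
      (f.continuous.continuousWithinAt.tendsto_nhdsWithin hmaps)
    have := hlim.const_mul (M⁻¹ ^ 2 * (ENNReal.ofReal ((R ^ N)⁻¹)).toReal)
    rw [mul_zero] at this
    refine this.congr fun t => ?_
    rw [Function.comp_apply, mul_assoc,
      ← integral_homeo e hme U (fun x => (u x (f t) - u x (f t₀)) ^ 2), ← integral_const_mul]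
    refine integral_congr_ae (Eventually.of_forall fun x => ?_)
    simp only [ht, hx]
    ring

/-- Scaling of the weak formulation. -/
lemma weak_scale {N : ℕ} {p s R M θ τ T : ℝ} (hR : 0 < R)
    (hM : 0 < M) (hθ : 0 < θ) (hθM : θ = M ^ (2 - p) * R ^ (s * p)) (hτ : τ ≤ 0)
    (hT : T ≤ -2 * θ + τ) (u : Euc N → ℝ → ℝ) (K : Euc N → ℝ)
    (hu : ∀ φ : Euc N × ℝ → ℝ, ContDiff ℝ (⊤ : ℕ∞) φ → HasCompactSupport φ →
    tsupport φ ⊆ ball 0 (2 * R) ×ˢ interior (Ioc T 0) →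
    -(∫ t in Ioc T 0, ∫ x in ball 0 (2 * R), u x t * deriv (fun τ => φ (x, τ)) t) +
      (1 / 2) * ∫ t in Ioc T 0, ∫ x, ∫ y,
        Jp p (u x t - u y t) * (φ (x, t) - φ (y, t)) * K (x - y) = 0)
    (v : Euc N → ℝ → ℝ) (hv : v = fun x t => M⁻¹ * u (R • x) (θ * t + τ)) :
    ∀ φ : Euc N × ℝ → ℝ, ContDiff ℝ (⊤ : ℕ∞) φ → HasCompactSupport φ →
    tsupport φ ⊆ ball 0 2 ×ˢ interior (Ioc (-2) 0) →
    -(∫ t in Ioc (-2) 0, ∫ x in ball 0 2, v x t * deriv (fun τ => φ (x, τ)) t) +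
      (1 / 2) * ∫ t in Ioc (-2) 0, ∫ x, ∫ y,
        Jp p (v x t - v y t) * (φ (x, t) - φ (y, t)) *
          (R ^ ((N : ℝ) + s * p) * K (R • (x - y))) = 0 := by
  subst hv
  intro φ hφ hφc hφs
  have hM' := inv_pos.2 hM
  set e := eSp N R hR.ne' with he
  set f := eTm θ τ hθ.ne' with hf
  have hme : Measure.map e volume = ENNReal.ofReal ((R ^ N)⁻¹) • (volume : Measure (Euc N)) :=
    map_eSp N R hR
  have hmf : Measure.map f volume = ENNReal.ofReal (θ⁻¹) • (volume : Measure ℝ) :=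
    map_eTm θ τ hθ
  have ht : ∀ t, θ * t + τ = f t := fun t => rfl
  have hx : ∀ x : Euc N, R • x = e x := fun x => rfl
  set g := e.prodCongr f with hg
  set ψ : Euc N × ℝ → ℝ := φ ∘ g.symm with hψ
  have hgs : ∀ q : Euc N × ℝ, g.symm q = (R⁻¹ • q.1, θ⁻¹ * (q.2 - τ)) := by
    intro q
    rw [Homeomorph.symm_apply_eq]
    ext1
    · change _ = R • (R⁻¹ • q.1)
      rw [smul_smul, mul_inv_cancel₀ hR.ne', one_smul]
    · change _ = θ * (θ⁻¹ * (q.2 - τ)) + τ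
      field_simp
      ring
  have hψφ : ∀ x t, φ (x, t) = ψ (e x, f t) := by
    intro x t
    change φ (x, t) = φ (g.symm (g (x, t)))
    rw [g.symm_apply_apply]
  have hψd : ContDiff ℝ (⊤ : ℕ∞) ψ := by
    have : ψ = fun q => φ (R⁻¹ • q.1, θ⁻¹ * (q.2 - τ)) := by
      ext q; rw [hψ, Function.comp_apply, hgs]
    rw [this]
    fun_prop
  have hψc : HasCompactSupport ψ := hφc.comp_homeomorph g.symm
  have htsu : tsupport ψ = g '' tsupport φ := by
    rw [hψ, tsupport_comp_eq_preimage, ← g.image_eq_preimage_symm]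
  have hmem : ∀ t ∈ Ioo (-2 : ℝ) 0, f t ∈ Ioo T 0 := by
    rintro t ⟨h1, h2⟩
    rw [hf, eTm_apply]
    constructor <;> nlinarith
  rw [interior_Ioc] at hφs
  have hψs : tsupport ψ ⊆ ball 0 (2 * R) ×ˢ interior (Ioc T 0) := by
    rw [htsu, interior_Ioc]
    rintro _ ⟨⟨x, t⟩, hq, rfl⟩
    obtain ⟨hq1, hq2⟩ := hφs hq
    refine ⟨?_, hmem t hq2⟩
    rw [← image_eSp_ball N hR]
    exact ⟨x, hq1, rfl⟩
  have key := hu ψ hψd hψc hψs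
  rw [interior_Ioc] at hψs
  -- vanishing outside the time interval
  have van : ∀ (χ : Euc N × ℝ → ℝ) (A : Set (Euc N)) (S : ℝ), tsupport χ ⊆ A ×ˢ Ioo S 0 →
      ∀ t ∉ Ioc S 0, ∀ x, χ (x, t) = 0 ∧ deriv (fun τ => χ (x, τ)) t = 0 := by
    intro χ A S hχ t htS x
    have hn : (x, t) ∉ tsupport χ := fun h => htS (Ioo_subset_Ioc_self (hχ h).2)
    refine ⟨image_eq_zero_of_notMem_tsupport hn, ?_⟩
    have h0 : χ =ᶠ[𝓝 (x, t)] 0 := notMem_tsupport_iff_eventuallyEq.1 hn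
    have h1 : (fun τ => χ (x, τ)) =ᶠ[𝓝 t] fun _ => 0 :=
      (Continuous.prodMk_right x).continuousAt.eventually h0
    rw [h1.deriv_eq, deriv_const]
  have vφ := van φ _ _ hφs
  have vψ := van ψ _ _ hψs
  rw [setIntegral_eq_integral_of_forall_compl_eq_zero
      (fun t h => by simp [fun x => (vψ t h x).2]),
    setIntegral_eq_integral_of_forall_compl_eq_zero
      (fun t h => by simp [fun x => (vψ t h x).1])] at key
  rw [setIntegral_eq_integral_of_forall_compl_eq_zero
      (fun t h => by simp [fun x => (vφ t h x).2]),
    setIntegral_eq_integral_of_forall_compl_eq_zero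
      (fun t h => by simp [fun x => (vφ t h x).1])]
  have hc1 : (ENNReal.ofReal ((R ^ N)⁻¹)).toReal = (R ^ N)⁻¹ :=
    ENNReal.toReal_ofReal (by positivity)
  have hc2 : (ENNReal.ofReal (θ⁻¹)).toReal = θ⁻¹ :=
    ENNReal.toReal_ofReal (by positivity)
  -- the time term
  have hder : ∀ x t, deriv (fun τ => φ (x, τ)) t = θ * deriv (fun σ => ψ (e x, σ)) (f t) := by
    intro x t
    have hd : DifferentiableAt ℝ (fun σ => ψ (e x, σ)) (f t) := by
      have : ContDiff ℝ (⊤ : ℕ∞) (fun σ => ψ (e x, σ)) := by fun_prop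
      exact (this.differentiable (by simp)).differentiableAt
    have hfd : HasDerivAt f θ t := by
      have := ((hasDerivAt_id t).const_mul θ).add_const τ
      rw [mul_one] at this
      exact this
    have := hd.hasDerivAt.comp t hfd
    simp_rw [hψφ]
    rw [mul_comm]
    exact this.deriv
  have T1 : ∫ t, ∫ x in ball (0 : Euc N) 2, M⁻¹ * u (R • x) (θ * t + τ) *
        deriv (fun τ => φ (x, τ)) t =
      (M⁻¹ * (R ^ N)⁻¹) * ∫ t, ∫ x in ball (0 : Euc N) (2 * R),
        u x t * deriv (fun σ => ψ (x, σ)) t := by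
    have h1 : ∀ t, ∫ x in ball (0 : Euc N) 2, M⁻¹ * u (R • x) (θ * t + τ) *
        deriv (fun τ => φ (x, τ)) t = (M⁻¹ * θ * (R ^ N)⁻¹) *
        ∫ x in ball (0 : Euc N) (2 * R), u x (f t) * deriv (fun σ => ψ (x, σ)) (f t) := by
      intro t
      have := integral_homeo e hme (ball (0 : Euc N) 2)
        (fun x => u x (f t) * deriv (fun σ => ψ (x, σ)) (f t))
      rw [image_eSp_ball N hR, hc1] at this
      rw [mul_assoc, ← this, ← integral_const_mul]
      refine integral_congr_ae (Eventually.of_forall fun x => ?_)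
      simp only [hder, ht, hx]
      ring
    simp_rw [h1]
    rw [integral_const_mul, integral_homeo_univ f hmf (fun t =>
      ∫ x in ball (0 : Euc N) (2 * R), u x t * deriv (fun σ => ψ (x, σ)) t), hc2]
    field_simp
  have T2 : ∫ t, ∫ x, ∫ y, Jp p (M⁻¹ * u (R • x) (θ * t + τ) - M⁻¹ * u (R • y) (θ * t + τ)) *
        (φ (x, t) - φ (y, t)) * (R ^ ((N : ℝ) + s * p) * K (R • (x - y))) =
      (M⁻¹ * (R ^ N)⁻¹) * ∫ t, ∫ x, ∫ y,
        Jp p (u x t - u y t) * (ψ (x, t) - ψ (y, t)) * K (x - y) := by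
    have h1 : ∀ t x y, Jp p (M⁻¹ * u (R • x) (θ * t + τ) - M⁻¹ * u (R • y) (θ * t + τ)) *
        (φ (x, t) - φ (y, t)) * (R ^ ((N : ℝ) + s * p) * K (R • (x - y))) =
        (M⁻¹ ^ (p - 1) * R ^ ((N : ℝ) + s * p)) *
        (Jp p (u (e x) (f t) - u (e y) (f t)) * (ψ (e x, f t) - ψ (e y, f t)) *
          K (e x - e y)) := by
      intro t x y
      rw [← mul_sub, Jp_scale hM, smul_sub, hψφ, hψφ, ht, hx, hx]
      ring
    simp_rw [h1, integral_const_mul]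
    simp_rw [fun t x => integral_homeo_univ e hme (fun y =>
      Jp p (u (e x) (f t) - u y (f t)) * (ψ (e x, f t) - ψ (y, f t)) * K (e x - y)),
      integral_const_mul]
    simp_rw [fun t => integral_homeo_univ e hme (fun x => ∫ y,
      Jp p (u x (f t) - u y (f t)) * (ψ (x, f t) - ψ (y, f t)) * K (x - y)),
      integral_const_mul]
    rw [integral_homeo_univ f hmf (fun t => ∫ x, ∫ y,
      Jp p (u x t - u y t) * (ψ (x, t) - ψ (y, t)) * K (x - y)), hc1, hc2]
    have hconst : M⁻¹ ^ (p - 1) * R ^ ((N : ℝ) + s * p) * ((R ^ N)⁻¹ * ((R ^ N)⁻¹ * θ⁻¹)) =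
        M⁻¹ * (R ^ N)⁻¹ := by
      have hMM : M⁻¹ ^ (p - 1) = M⁻¹ * M ^ (2 - p) := by
        rw [Real.inv_rpow hM.le, ← Real.rpow_neg hM.le, ← Real.rpow_neg_one M,
          ← Real.rpow_add hM]
        congr 1
        ring
      have := (Real.rpow_pos_of_pos hM (2 - p)).ne'
      have := (Real.rpow_pos_of_pos hR (s * p)).ne'
      rw [hMM, Real.rpow_add hR, Real.rpow_natCast, hθM]
      field_simp
    rw [← hconst]
    ring
  rw [T1, T2]
  linear_combination (M⁻¹ * (R ^ N)⁻¹) * key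

/-- normalisation for `p ≥ 2`. -/
theorem normalisation_superquadratic
    (N : ℕ) (hN : 1 ≤ N) (p s lam Lam R : ℝ)
    (hp : 2 ≤ p) (hs : s ∈ Ioo (0 : ℝ) 1) (hlam : 0 < lam) (hlamLam : lam ≤ Lam)
    (hR : 0 < R)
    (K : Euc N → ℝ) (hK : IsKernel N p s lam Lam K)
    (u : Euc N → ℝ → ℝ)
    (hu : IsLocalWeakSolution N p s K (ball 0 (2 * R)) (Ioc (-(2 * R ^ (s * p))) 0) u)
    (hfin : MR N p s u 0 R 0 ≠ ⊤)
    (τ : ℝ)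
    (hτ : τ ∈ Icc (-(R ^ (s * p)) * (1 - (MR N p s u 0 R 0).toReal ^ (2 - p))) 0) :
    IsKernel N p s lam Lam (fun z => R ^ ((N : ℝ) + s * p) * K (R • z)) ∧
    IsLocalWeakSolution N p s (fun z => R ^ ((N : ℝ) + s * p) * K (R • z))
      (ball 0 2) (Ioc (-2) 0)
      (fun x t => ((MR N p s u 0 R 0).toReal)⁻¹ *
        u (R • x) ((MR N p s u 0 R 0).toReal ^ (2 - p) * R ^ (s * p) * t + τ)) ∧
    supAbs N
      (fun x t => ((MR N p s u 0 R 0).toReal)⁻¹ *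
        u (R • x) ((MR N p s u 0 R 0).toReal ^ (2 - p) * R ^ (s * p) * t + τ))
      (ball 0 2 ×ˢ Ioc (-2) 0)
      + tailSup N p s
        (fun x t => ((MR N p s u 0 R 0).toReal)⁻¹ *
          u (R • x) ((MR N p s u 0 R 0).toReal ^ (2 - p) * R ^ (s * p) * t + τ))
        0 1 (Ioc (-1) 0) ≤ 1 := by
  have hMR1 : 1 ≤ MR N p s u 0 R 0 := by
    unfold MR
    exact le_add_self
  have hM1 : 1 ≤ (MR N p s u 0 R 0).toReal := by
    rw [← ENNReal.toReal_one]
    exact ENNReal.toReal_mono hfin hMR1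
  have hofM : ENNReal.ofReal (MR N p s u 0 R 0).toReal = MR N p s u 0 R 0 :=
    ENNReal.ofReal_toReal hfin
  have hMRdef : supAbs N u (ball 0 (2 * R) ×ˢ Ioc (-(2 * R ^ (s * p))) 0)
    + tailSup N p s u 0 R (Ioc (-(2 * R ^ (s * p))) 0) + 1 = MR N p s u 0 R 0 := by
    simp only [MR, zero_sub]
  generalize (MR N p s u 0 R 0).toReal = M at *
  have hM : 0 < M := by linarith
  have hRsp : 0 < R ^ (s * p) := Real.rpow_pos_of_pos hR _
  have hMp : M ^ (2 - p) ≤ 1 := Real.rpow_le_one_of_one_le_of_nonpos hM1 (by linarith)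
  have hMp0 : 0 < M ^ (2 - p) := Real.rpow_pos_of_pos hM _
  obtain ⟨hτ1, hτ0⟩ := hτ
  obtain ⟨θ, hθM⟩ : ∃ θ, θ = M ^ (2 - p) * R ^ (s * p) := ⟨_, rfl⟩
  have hθ : 0 < θ := by rw [hθM]; positivity
  have hT : -(2 * R ^ (s * p)) ≤ -2 * θ + τ := by rw [hθM]; nlinarith
  have hT1 : θ ≤ R ^ (s * p) := by rw [hθM]; nlinarith
  rw [← hθM]
  refine ⟨isKernel_scale hR hK, ⟨?_, ?_⟩, ?_⟩
  · exact local_scale hR hM hθ hτ0 hT u hu.1 _ rfl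
  · exact weak_scale hR hM hθ hθM hτ0 hT u K hu.2 _ rfl
  · have hme := map_eSp N R hR
    have hmf := map_eTm θ τ hθ
    have hIoc : MapsTo (eTm θ τ hθ.ne') (Ioc (-2) 0) (Ioc (-(2 * R ^ (s * p))) 0) := by
      rintro t ⟨h1, h2⟩
      rw [eTm_apply]
      constructor <;> nlinarith
    have hprod : Measure.map ((eSp N R hR.ne').prodCongr (eTm θ τ hθ.ne')) volume =
        (ENNReal.ofReal ((R ^ N)⁻¹) * ENNReal.ofReal (θ⁻¹)) •
          (volume : Measure (Euc N × ℝ)) := by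
      have h1 := Measure.map_prod_map (volume : Measure (Euc N)) (volume : Measure ℝ)
        (eSp N R hR.ne').measurable (eTm θ τ hθ.ne').measurable
      rw [hme, hmf, Measure.prod_smul_left, Measure.prod_smul_right, smul_smul] at h1
      exact h1.symm
    have hS : supAbs N (fun x t => M⁻¹ * u (R • x) (θ * t + τ)) (ball 0 2 ×ˢ Ioc (-2) 0) ≤
        ENNReal.ofReal M⁻¹ * supAbs N u (ball 0 (2 * R) ×ˢ Ioc (-(2 * R ^ (s * p))) 0) := by
      refine essSup_homeo_le _ hprod ?_ fun q => ?_
      · rintro _ ⟨⟨x, t⟩, ⟨hx, ht⟩, rfl⟩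
        refine ⟨?_, hIoc ht⟩
        rw [← image_eSp_ball N hR]
        exact ⟨x, hx, rfl⟩
      · rw [← ENNReal.ofReal_mul (by positivity), abs_mul, abs_of_pos (inv_pos.2 hM)]
        rfl
    have hTl : tailSup N p s (fun x t => M⁻¹ * u (R • x) (θ * t + τ)) 0 1 (Ioc (-1) 0) ≤
        ENNReal.ofReal M⁻¹ * tailSup N p s u 0 R (Ioc (-(2 * R ^ (s * p))) 0) := by
      refine essSup_homeo_le (eTm θ τ hθ.ne') hmf ?_ fun t => ?_
      · rintro _ ⟨t, ht, rfl⟩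
        exact hIoc ⟨by linarith [ht.1], ht.2⟩
      · rw [← ENNReal.ofReal_mul (by positivity)]
        exact (congrArg ENNReal.ofReal
          (tailFn_scale hp hR hM (fun x => u x (θ * t + τ)))).le
    calc _ ≤ _ := add_le_add hS hTl
      _ = ENNReal.ofReal M⁻¹ * (supAbs N u (ball 0 (2 * R) ×ˢ Ioc (-(2 * R ^ (s * p))) 0)
          + tailSup N p s u 0 R (Ioc (-(2 * R ^ (s * p))) 0)) := by rw [mul_add]
      _ ≤ ENNReal.ofReal M⁻¹ * ENNReal.ofReal M := by
          rw [hofM, ← hMRdef]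
          exact mul_le_mul_right le_self_add _
      _ = 1 := by
          rw [← ENNReal.ofReal_mul (by positivity), inv_mul_cancel₀ hM.ne', ENNReal.ofReal_one]
end
end
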